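/- Let G be a simple connected positively curved (in the Lin–Lu–Yau sense) planar graph with minimum degree at least 3. Then the maximum degree of G is at most 17. -/

import Mathlib

open Filter Set

variable {V : Type*}

-- The `α`-lazy random walk distribution at vertex `x`.
open Classical in
noncomputable def lazyWalk (G : SimpleGraph V) [G.LocallyFinite] (α : ℝ) (x : V) : V → ℝ :=
  fun v => if v = x then α else if G.Adj x v then (1 - α) / (G.degree x : ℝ) else 0

/-- `A` is a coupling between the finitely supported distributions `m₁` and `m₂`. -/
def IsCoupling (m₁ m₂ : V → ℝ) (A : V → V → ℝ) : Prop :=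
  (Function.support fun p : V × V => A p.1 p.2).Finite ∧
  (∀ x y, 0 ≤ A x y ∧ A x y ≤ 1) ∧
  (∀ x, ∑ᶠ y, A x y = m₁ x) ∧
  (∀ y, ∑ᶠ x, A x y = m₂ y)

/-- The transportation (Wasserstein) distance between two distributions on `V`,
with respect to the graph distance of `G`. -/
noncomputable def transportDist (G : SimpleGraph V) (m₁ m₂ : V → ℝ) : ℝ :=
  sInf {w : ℝ | ∃ A : V → V → ℝ, IsCoupling m₁ m₂ A ∧
    w = ∑ᶠ p : V × V, A p.1 p.2 * (G.dist p.1 p.2 : ℝ)}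

/-- The `α`-Ricci curvature `κ_α(x,y)`. -/
noncomputable def alphaRicci (G : SimpleGraph V) [G.LocallyFinite] (α : ℝ) (x y : V) : ℝ :=
  1 - transportDist G (lazyWalk G α x) (lazyWalk G α y) / (G.dist x y : ℝ)

/-- `κ` is the Lin–Lu–Yau Ricci curvature of the pair `(x,y)`:
the limit of `κ_α(x,y)/(1-α)` as `α → 1⁻`. -/
def HasLLYCurv (G : SimpleGraph V) [G.LocallyFinite] (x y : V) (κ : ℝ) : Prop :=
  Tendsto (fun α : ℝ => alphaRicci G α x y / (1 - α)) (nhdsWithin 1 (Set.Iio 1)) (nhds κ)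

/-- `G` is positively curved: every edge has positive Lin–Lu–Yau Ricci curvature. -/
def PositivelyCurved (G : SimpleGraph V) [G.LocallyFinite] : Prop :=
  ∀ ⦃x y : V⦄, G.Adj x y → ∃ κ : ℝ, 0 < κ ∧ HasLLYCurv G x y κ

/-- `G` is planar: it admits a topological embedding in the plane, i.e. an injective
placement of the vertices together with arcs for the edges, where arcs are injective
continuous curves joining the endpoints, not passing through any other vertex, and
two arcs of distinct edges meet only in common endpoints. -/
def IsPlanar (G : SimpleGraph V) : Prop :=
  ∃ (f : V → ℝ × ℝ) (e : ∀ u v : V, G.Adj u v → Set.Icc (0:ℝ) 1 → ℝ × ℝ),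
    Function.Injective f ∧
    (∀ u v (h : G.Adj u v), Continuous (e u v h)) ∧
    (∀ u v (h : G.Adj u v), Function.Injective (e u v h)) ∧
    (∀ u v (h : G.Adj u v),
      e u v h ⟨0, Set.left_mem_Icc.mpr zero_le_one⟩ = f u ∧
      e u v h ⟨1, Set.right_mem_Icc.mpr zero_le_one⟩ = f v) ∧
    (∀ u v (h : G.Adj u v) (w : V), w ≠ u → w ≠ v → f w ∉ Set.range (e u v h)) ∧
    (∀ u v (h : G.Adj u v) (u' v' : V) (h' : G.Adj u' v'), ({u, v} : Set V) ≠ {u', v'} →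
      Set.range (e u v h) ∩ Set.range (e u' v' h') ⊆ (f '' {u, v}) ∩ (f '' {u', v'}))


open Classical in
theorem mdl_lazy_sum (G : SimpleGraph V) [G.LocallyFinite] (α : ℝ) (x : V) (g : V → ℝ)
    (F : Finset V) (hx : x ∈ F) (hF : G.neighborFinset x ⊆ F) :
    ∑ v ∈ F, lazyWalk G α x v * g v =
      α * g x + (1 - α) / (G.degree x : ℝ) * ∑ v ∈ G.neighborFinset x, g v := by
  have hsub : insert x (G.neighborFinset x) ⊆ F := by
    intro v hv
    rcases Finset.mem_insert.mp hv with rfl | h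
    · exact hx
    · exact hF h
  rw [← Finset.sum_subset hsub]
  · rw [Finset.sum_insert (by simp)]
    congr 1
    · simp [lazyWalk]
    · rw [Finset.mul_sum]
      refine Finset.sum_congr rfl ?_
      intro v hv
      have hv' : G.Adj x v := by simpa using hv
      simp [lazyWalk, hv', hv'.ne']
  · intro v _ hv
    have h1 : v ≠ x := by rintro rfl; simp at hv
    have h2 : ¬ G.Adj x v := by intro h; simp [h] at hv
    simp [lazyWalk, h1, h2]

theorem mdl_lazy_support (G : SimpleGraph V) [G.LocallyFinite] (α : ℝ) (x v : V)
    (h1 : v ≠ x) (h2 : ¬ G.Adj x v) : lazyWalk G α x v = 0 := by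
  simp [lazyWalk, h1, h2]

theorem mdl_lazy_nonneg (G : SimpleGraph V) [G.LocallyFinite] (α : ℝ) (h0 : 0 ≤ α) (h1 : α ≤ 1)
    (x v : V) : 0 ≤ lazyWalk G α x v := by
  unfold lazyWalk
  split_ifs
  · exact h0
  · exact div_nonneg (by linarith) (Nat.cast_nonneg _)
  · exact le_rfl

theorem mdl_lip (G : SimpleGraph V) (hconn : G.Connected) (φ : V → ℝ)
    (h : ∀ u v, G.Adj u v → φ v - φ u ≤ 1) (u v : V) : φ v - φ u ≤ G.dist u v := by
  obtain ⟨p, hp⟩ := (hconn u v).exists_walk_length_eq_dist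
  rw [← hp]
  clear hp
  induction p with
  | nil => simp
  | cons hadj p ih =>
    have := h _ _ hadj
    simp only [SimpleGraph.Walk.length_cons]
    push_cast
    linarith

open Classical in
theorem mdl_coupling_lower (G : SimpleGraph V) (hconn : G.Connected) (m₁ m₂ : V → ℝ)
    (φ : V → ℝ) (h : ∀ u v, G.Adj u v → φ v - φ u ≤ 1) (A : V → V → ℝ) (hA : IsCoupling m₁ m₂ A)
    (F₀ : Finset V) :
    ∃ F : Finset V, F₀ ⊆ F ∧ ∑ v ∈ F, m₂ v * φ v - ∑ v ∈ F, m₁ v * φ v ≤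
      ∑ᶠ p : V × V, A p.1 p.2 * (G.dist p.1 p.2 : ℝ) := by
  obtain ⟨hfin, h01, hm1, hm2⟩ := hA
  set F : Finset V := F₀ ∪ hfin.toFinset.image Prod.fst ∪ hfin.toFinset.image Prod.snd with hF
  have hz1 : ∀ a b, A a b ≠ 0 → a ∈ F ∧ b ∈ F := by
    intro a b hab
    have hmem : (a, b) ∈ hfin.toFinset := by simpa using hab
    constructor
    · simp only [hF, Finset.mem_union]
      exact Or.inl (Or.inr (Finset.mem_image_of_mem Prod.fst hmem))
    · simp only [hF, Finset.mem_union]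
      exact Or.inr (Finset.mem_image_of_mem Prod.snd hmem)
  refine ⟨F, fun a ha => by simp [hF, ha], ?_⟩
  have e1 : ∀ a, m₁ a = ∑ b ∈ F, A a b := by
    intro a
    rw [← hm1 a]
    apply finsum_eq_sum_of_support_subset
    intro b hb
    exact (hz1 a b hb).2
  have e2 : ∀ b, m₂ b = ∑ a ∈ F, A a b := by
    intro b
    rw [← hm2 b]
    apply finsum_eq_sum_of_support_subset
    intro a ha
    exact (hz1 a b ha).1
  have e3 : ∑ᶠ p : V × V, A p.1 p.2 * (G.dist p.1 p.2 : ℝ) =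
      ∑ p ∈ F ×ˢ F, A p.1 p.2 * (G.dist p.1 p.2 : ℝ) := by
    apply finsum_eq_sum_of_support_subset
    intro p hp
    have hp' : A p.1 p.2 ≠ 0 := by
      intro h0
      apply hp
      simp [h0]
    have := hz1 _ _ hp'
    simp [this.1, this.2]
  rw [e3, Finset.sum_product]
  have l2 : ∑ v ∈ F, m₂ v * φ v = ∑ a ∈ F, ∑ b ∈ F, A a b * φ b := by
    rw [Finset.sum_comm]
    refine Finset.sum_congr rfl fun b _ => ?_
    rw [e2, Finset.sum_mul]
  have l1 : ∑ v ∈ F, m₁ v * φ v = ∑ a ∈ F, ∑ b ∈ F, A a b * φ a := by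
    refine Finset.sum_congr rfl fun b _ => ?_
    rw [e1, Finset.sum_mul]
  rw [l1, l2, ← Finset.sum_sub_distrib]
  refine Finset.sum_le_sum fun a _ => ?_
  rw [← Finset.sum_sub_distrib]
  refine Finset.sum_le_sum fun b _ => ?_
  rw [← mul_sub]
  exact mul_le_mul_of_nonneg_left (mdl_lip G hconn φ h a b) (h01 a b).1

open Classical in
theorem mdl_coupling_exists (G : SimpleGraph V) [G.LocallyFinite] (α : ℝ) (h0 : 0 ≤ α) (h1 : α ≤ 1)
    (x y : V) (hx : G.degree x ≠ 0) (hy : G.degree y ≠ 0) :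
    IsCoupling (lazyWalk G α x) (lazyWalk G α y)
      (fun a b => lazyWalk G α x a * lazyWalk G α y b) := by
  have tot : ∀ z, G.degree z ≠ 0 → ∑ v ∈ insert z (G.neighborFinset z), lazyWalk G α z v = 1 := by
    intro z hz
    have := mdl_lazy_sum G α z (fun _ => 1) (insert z (G.neighborFinset z)) (by simp) (by simp)
    simp only [mul_one] at this
    rw [this]
    simp only [Finset.sum_const, SimpleGraph.card_neighborFinset_eq_degree, nsmul_eq_mul, mul_one]
    have : (G.degree z : ℝ) ≠ 0 := by exact_mod_cast hz
    field_simp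
    ring
  have sup : ∀ z, Function.support (lazyWalk G α z) ⊆ (insert z (G.neighborFinset z) : Finset V) := by
    intro z v hv
    by_contra hn
    simp only [Finset.coe_insert, SimpleGraph.coe_neighborFinset, Set.mem_insert_iff,
      SimpleGraph.mem_neighborSet, not_or] at hn
    exact hv (mdl_lazy_support G α z v hn.1 hn.2)
  have tot' : ∀ z, G.degree z ≠ 0 → ∑ᶠ v, lazyWalk G α z v = 1 := by
    intro z hz
    rw [finsum_eq_sum_of_support_subset _ (sup z), tot z hz]
  have le1 : ∀ z, G.degree z ≠ 0 → ∀ v, lazyWalk G α z v ≤ 1 := by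
    intro z hz v
    by_cases hv : v ∈ insert z (G.neighborFinset z)
    · rw [← tot z hz]
      exact Finset.single_le_sum (fun i _ => mdl_lazy_nonneg G α h0 h1 z i) hv
    · have : lazyWalk G α z v = 0 := by
        by_contra hne
        exact hv (sup z hne)
      rw [this]; exact zero_le_one
  refine ⟨?_, ?_, ?_, ?_⟩
  · refine Set.Finite.subset ((insert x (G.neighborFinset x) : Finset V) ×ˢ
      (insert y (G.neighborFinset y) : Finset V)).finite_toSet ?_
    rintro ⟨a, b⟩ hab
    have hab' : lazyWalk G α x a * lazyWalk G α y b ≠ 0 := hab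
    rw [Finset.coe_product]
    exact ⟨sup x (left_ne_zero_of_mul hab'), sup y (right_ne_zero_of_mul hab')⟩
  · intro a b
    exact ⟨mul_nonneg (mdl_lazy_nonneg G α h0 h1 x a) (mdl_lazy_nonneg G α h0 h1 y b),
      mul_le_one₀ (le1 x hx a) (mdl_lazy_nonneg G α h0 h1 y b) (le1 y hy b)⟩
  · intro a
    rw [← mul_finsum, tot' y hy, mul_one]
  · intro b
    rw [← finsum_mul, tot' x hx, one_mul]

open Classical in
theorem mdl_star_real (G : SimpleGraph V) [G.LocallyFinite] (hconn : G.Connected)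
    (hpos : PositivelyCurved G) {x y : V} (hxy : G.Adj x y)
    (φ : V → ℝ) (h : ∀ u v, G.Adj u v → φ v - φ u ≤ 1) (hφx : φ x = 0) (hφy : φ y = 1) :
    (∑ v ∈ G.neighborFinset y, φ v) / (G.degree y : ℝ) <
      1 + (∑ v ∈ G.neighborFinset x, φ v) / (G.degree x : ℝ) := by
  obtain ⟨κ, hκ, hlim⟩ := hpos hxy
  have hdx : G.degree x ≠ 0 := by
    rw [← Nat.pos_iff_ne_zero, G.degree_pos_iff_exists_adj]; exact ⟨y, hxy⟩
  have hdy : G.degree y ≠ 0 := by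
    rw [← Nat.pos_iff_ne_zero, G.degree_pos_iff_exists_adj]; exact ⟨x, hxy.symm⟩
  have hb : ∀ α : ℝ, 0 < α → α < 1 → alphaRicci G α x y / (1 - α) ≤
      1 + (∑ v ∈ G.neighborFinset x, φ v) / (G.degree x : ℝ) -
        (∑ v ∈ G.neighborFinset y, φ v) / (G.degree y : ℝ) := by
    intro α h0 h1
    have hW : α + (1 - α) / (G.degree y : ℝ) * (∑ v ∈ G.neighborFinset y, φ v) -
        (1 - α) / (G.degree x : ℝ) * (∑ v ∈ G.neighborFinset x, φ v) ≤
        transportDist G (lazyWalk G α x) (lazyWalk G α y) := by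
      apply le_csInf
      · exact ⟨_, _, mdl_coupling_exists G α h0.le h1.le x y hdx hdy, rfl⟩
      · rintro w ⟨A, hA, rfl⟩
        obtain ⟨F, hF, hle⟩ := mdl_coupling_lower G hconn _ _ φ h A hA
          (insert x (insert y (G.neighborFinset x ∪ G.neighborFinset y)))
        rw [mdl_lazy_sum G α y φ F (hF (by simp)) (fun v hv => hF (by
            simp only [Finset.mem_insert, Finset.mem_union]; tauto)),
          mdl_lazy_sum G α x φ F (hF (by simp)) (fun v hv => hF (by
            simp only [Finset.mem_insert, Finset.mem_union]; tauto)), hφx, hφy] at hle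
        linarith
    rw [alphaRicci, SimpleGraph.dist_eq_one_iff_adj.mpr hxy, div_le_iff₀ (by linarith)]
    simp only [Nat.cast_one, div_one]
    have e1 : (1 - α) / (G.degree y : ℝ) * (∑ v ∈ G.neighborFinset y, φ v) =
      (∑ v ∈ G.neighborFinset y, φ v) / (G.degree y : ℝ) * (1 - α) := by ring
    have e2 : (1 - α) / (G.degree x : ℝ) * (∑ v ∈ G.neighborFinset x, φ v) =
      (∑ v ∈ G.neighborFinset x, φ v) / (G.degree x : ℝ) * (1 - α) := by ring
    rw [e1, e2] at hW
    linarith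
  have : κ ≤ 1 + (∑ v ∈ G.neighborFinset x, φ v) / (G.degree x : ℝ) -
        (∑ v ∈ G.neighborFinset y, φ v) / (G.degree y : ℝ) := by
    refine le_of_tendsto hlim ?_
    have : Set.Ioo (0:ℝ) 1 ∈ nhdsWithin (1:ℝ) (Set.Iio 1) := Ioo_mem_nhdsLT zero_lt_one
    filter_upwards [this] with α hα
    exact hb α hα.1 hα.2
  linarith

open Classical in
theorem mdl_star (G : SimpleGraph V) [G.LocallyFinite] (hconn : G.Connected)
    (hpos : PositivelyCurved G) {x y : V} (hxy : G.Adj x y) (hD : 18 ≤ G.degree x)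
    (S Z M : Finset V) (hS : ∀ u ∈ S, G.Adj y u ∧ u ≠ x)
    (hZ : ∀ z, G.Adj x z → z ≠ y → (G.Adj y z ∨ ∃ u ∈ S, G.Adj u z) → z ∈ Z)
    (hM : ∀ u ∈ S, G.Adj x u → u ∈ M) :
    18 * S.card < G.degree y * (2 + Z.card + M.card) := by
  set φ : V → ℝ := fun v => if v = y ∨ v ∈ S then 1 else
    if G.Adj y v ∨ ∃ u ∈ S, G.Adj u v then 0 else -1 with hφ
  have hyS : y ∉ S := fun h => (hS y h).1.ne rfl
  have hxS : x ∉ S := fun h => (hS x h).2 rfl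
  have hlip : ∀ u v, G.Adj u v → φ v - φ u ≤ 1 := by
    intro u v huv
    by_cases hv : v = y ∨ v ∈ S
    · have : 0 ≤ φ u := by
        simp only [hφ]
        have hu : G.Adj y u ∨ ∃ w ∈ S, G.Adj w u := by
          rcases hv with rfl | hv
          · exact Or.inl huv.symm
          · exact Or.inr ⟨v, hv, huv.symm⟩
        rw [if_pos hu]
        split_ifs <;> norm_num
      have h2 : φ v = 1 := by simp only [hφ]; rw [if_pos hv]
      linarith
    · have h2 : φ v ≤ 0 := by
        simp only [hφ]; rw [if_neg hv]; split_ifs <;> norm_num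
      have h3 : -1 ≤ φ u := by
        simp only [hφ]; split_ifs <;> norm_num
      linarith
  have hφx : φ x = 0 := by
    simp only [hφ]
    rw [if_neg (by rintro (h | h); exact hxy.ne h; exact hxS h), if_pos (Or.inl hxy.symm)]
  have hφy : φ y = 1 := by simp [hφ]
  have key := mdl_star_real G hconn hpos hxy φ hlip hφx hφy
  have sy : ∑ v ∈ G.neighborFinset y, φ v = S.card := by
    have hsub : S ⊆ G.neighborFinset y := fun u hu => by simpa using (hS u hu).1
    rw [← Finset.sum_subset hsub]
    · rw [Finset.sum_congr rfl (g := fun _ => (1:ℝ))]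
      · simp
      · intro u hu; simp [hφ, hu]
    · intro u hu hu'
      have hu2 : G.Adj y u := by simpa using hu
      simp [hφ, hu2, hu', hu2.ne']
  have sx : ∑ v ∈ G.neighborFinset x, φ v ≤ 2 + Z.card + M.card - G.degree x := by
    have : ∑ v ∈ G.neighborFinset x, (φ v + 1) ≤ ∑ v ∈ G.neighborFinset x,
        ((if v = y then 2 else 0) + (if v ∈ Z then 1 else 0) + (if v ∈ M then 1 else 0) : ℝ) := by
      refine Finset.sum_le_sum fun v hv => ?_
      have hv' : G.Adj x v := by simpa using hv
      by_cases h1 : v = y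
      · subst h1
        rw [hφy]
        simp only [if_true]
        split_ifs <;> norm_num
      · by_cases h2 : v ∈ S
        · have hz : v ∈ Z := hZ v hv' h1 (Or.inl (hS v h2).1)
          have hm : v ∈ M := hM v h2 hv'
          simp [hφ, h1, h2, hz, hm]
        · by_cases h3 : G.Adj y v ∨ ∃ u ∈ S, G.Adj u v
          · have hz : v ∈ Z := hZ v hv' h1 h3
            have : φ v = 0 := by
              simp only [hφ]; rw [if_neg (by tauto), if_pos h3]
            rw [this, if_neg h1, if_pos hz]
            split_ifs <;> norm_num
          · have : φ v = -1 := by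
              simp only [hφ]; rw [if_neg (by tauto), if_neg h3]
            rw [this]
            split_ifs <;> norm_num
    rw [Finset.sum_add_distrib, Finset.sum_add_distrib, Finset.sum_add_distrib] at this
    have i1 : ∑ v ∈ G.neighborFinset x, (if v = y then 2 else 0 : ℝ) = 2 := by
      rw [Finset.sum_ite_eq' ]; simp [hxy]
    have i2 : ∀ T : Finset V, ∑ v ∈ G.neighborFinset x, (if v ∈ T then 1 else 0 : ℝ) ≤ T.card := by
      intro T
      rw [← Finset.sum_filter]
      simp only [Finset.sum_const, nsmul_eq_mul, mul_one]
      exact_mod_cast Finset.card_le_card (fun v hv => (Finset.mem_filter.mp hv).2)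
    have i3 := i2 Z
    have i4 := i2 M
    simp only [Finset.sum_const, SimpleGraph.card_neighborFinset_eq_degree, nsmul_eq_mul, mul_one] at this
    linarith
  have hDx : (18:ℝ) ≤ G.degree x := by exact_mod_cast hD
  have hDy : (0:ℝ) < G.degree y := by
    have : 0 < G.degree y := by
      rw [G.degree_pos_iff_exists_adj]; exact ⟨x, hxy.symm⟩
    exact_mod_cast this
  rw [sy] at key
  have k2 : (S.card : ℝ) / G.degree y < (2 + Z.card + M.card) / G.degree x := by
    have : (∑ v ∈ G.neighborFinset x, φ v) / (G.degree x : ℝ) ≤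
      (2 + Z.card + M.card - G.degree x) / (G.degree x : ℝ) := by gcongr
    rw [sub_div, div_self (by linarith)] at this
    linarith
  rw [div_lt_div_iff₀ hDy (by linarith)] at k2
  have k3 : (18:ℝ) * S.card ≤ S.card * G.degree x := by
    have : (0:ℝ) ≤ S.card := Nat.cast_nonneg _
    nlinarith
  have k4 : (18:ℝ) * S.card < G.degree y * (2 + Z.card + M.card) := by linarith
  exact_mod_cast k4

theorem mdl_const_of_exp_const (g : ℝ → ℂ) (hg : Continuous g) (c : ℂ)
    (h : ∀ s, Complex.exp (g s) = c) (a b : ℝ) : g a = g b := by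
  have hc := Complex.isCoveringMap_exp
  have : g = fun _ => g b := by
    refine hc.eq_of_comp_eq hg continuous_const ?_ b rfl
    funext s
    simp [h]
  rw [this]

/-- Angle change along a curve in the closed disc seen from a boundary point. -/
theorem mdl_side (R : ℝ → ℂ) (hR : Continuous R) (hR1 : ∀ s, ‖R s‖ ≤ 1) (ζ : ℂ) (hζ : ‖ζ‖ = 1)
    (hne : ∀ s, R s ≠ ζ) (h : ℝ → ℂ) (hh : Continuous h) (κ : ℂ)
    (he : ∀ s, Complex.exp (h s) = κ * (R s - ζ)) :
    h 1 - h 0 = Complex.log (1 - R 1 * ζ⁻¹) - Complex.log (1 - R 0 * ζ⁻¹) := by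
  have hζ0 : ζ ≠ 0 := by rintro rfl; simp at hζ
  have hκ : κ ≠ 0 := by
    rintro rfl
    have := he 0
    simp at this
  have hre : ∀ s, 0 < (1 - R s * ζ⁻¹).re := by
    intro s
    have h1 : ‖R s * ζ⁻¹‖ ≤ 1 := by
      rw [norm_mul, norm_inv, hζ]; simpa using hR1 s
    have h2 : R s * ζ⁻¹ ≠ 1 := by
      intro h3
      apply hne s
      field_simp at h3
      exact h3
    have h3 : (R s * ζ⁻¹).re < 1 := by
      refine lt_of_le_of_ne ((Complex.re_le_norm _).trans h1) ?_
      intro h4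
      apply h2
      apply Complex.ext
      · simpa using h4
      · have h5 := Complex.sq_norm (R s * ζ⁻¹)
        rw [Complex.normSq_apply, h4] at h5
        have h6 : ‖R s * ζ⁻¹‖ ^ 2 ≤ 1 := by
          have := norm_nonneg (R s * ζ⁻¹)
          nlinarith
        simp only [Complex.one_im]
        nlinarith [sq_nonneg (R s * ζ⁻¹).im]
    simpa using h3
  have key := mdl_const_of_exp_const (fun s => h s - Complex.log (1 - R s * ζ⁻¹)) (by
    refine hh.sub (Continuous.clog (by fun_prop) ?_)
    intro s
    exact Or.inl (hre s)) (-(κ * ζ)) (by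
    intro s
    have hn : (1 - R s * ζ⁻¹) ≠ 0 := by
      intro h0
      have := hre s
      rw [h0] at this
      simp at this
    rw [Complex.exp_sub, he, Complex.exp_log hn, div_eq_iff hn]
    field_simp
    ring) 1 0
  linear_combination key

theorem mdl_log_im (θ : ℝ) (h0 : 0 < θ) (h1 : θ < 2 * Real.pi) :
    (Complex.log (1 - Complex.exp (θ * Complex.I))).im = (θ - Real.pi) / 2 := by
  rw [Complex.log_im]
  have hs : 0 < 2 * Real.sin (θ / 2) := by
    have := Real.sin_pos_of_pos_of_lt_pi (x := θ / 2) (by linarith) (by linarith)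
    linarith
  have : (1 - Complex.exp (θ * Complex.I)) = ((2 * Real.sin (θ / 2) : ℝ) : ℂ) *
      (Complex.cos (((θ - Real.pi) / 2 : ℝ) : ℂ) + Complex.sin (((θ - Real.pi) / 2 : ℝ) : ℂ) * Complex.I) := by
    rw [← Complex.ofReal_cos, ← Complex.ofReal_sin, Complex.exp_mul_I, ← Complex.ofReal_cos, ← Complex.ofReal_sin]
    have e1 : (θ - Real.pi) / 2 = θ / 2 - Real.pi / 2 := by ring
    rw [e1, Real.cos_sub_pi_div_two, Real.sin_sub_pi_div_two]
    have e2 : θ = 2 * (θ / 2) := by ring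
    have c2 : Real.cos θ = 1 - 2 * Real.sin (θ / 2) ^ 2 := by
      conv_lhs => rw [e2, Real.cos_two_mul]
      have := Real.sin_sq_add_cos_sq (θ / 2)
      linarith
    have s2 : Real.sin θ = 2 * Real.sin (θ / 2) * Real.cos (θ / 2) := by
      conv_lhs => rw [e2, Real.sin_two_mul]
    rw [c2, s2]
    push_cast
    ring
  rw [this, Complex.arg_mul_cos_add_sin_mul_I hs]
  constructor <;> linarith [Real.pi_pos]

theorem mdl_log_im' (θ : ℝ) (h0 : θ < 0) (h1 : - (2 * Real.pi) < θ) :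
    (Complex.log (1 - Complex.exp (θ * Complex.I))).im = (θ + Real.pi) / 2 := by
  have := mdl_log_im (θ + 2 * Real.pi) (by linarith) (by linarith)
  have e : Complex.exp (((θ + 2 * Real.pi : ℝ) : ℂ) * Complex.I) = Complex.exp (θ * Complex.I) := by
    push_cast
    rw [add_mul, Complex.exp_add, Complex.exp_two_pi_mul_I, mul_one]
  rw [e] at this
  rw [this]; ring

theorem mdl_exp_div (a b : ℝ) : Complex.exp (a * Complex.I) * (Complex.exp (b * Complex.I))⁻¹ =
    Complex.exp (((a - b : ℝ) : ℂ) * Complex.I) := by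
  rw [← Complex.exp_neg, ← Complex.exp_add]; congr 1; push_cast; ring

/-- Two curves in the closed disc with alternating boundary endpoints intersect. -/
theorem mdl_disc (P Q : ℝ → ℂ) (hP : Continuous P) (hQ : Continuous Q)
    (hP1 : ∀ s, ‖P s‖ ≤ 1) (hQ1 : ∀ s, ‖Q s‖ ≤ 1) (a b c d : ℝ)
    (hab : a < b) (hbc : b < c) (hcd : c < d) (hda : d < a + 2 * Real.pi)
    (hPa : P 0 = Complex.exp (a * Complex.I)) (hPc : P 1 = Complex.exp (c * Complex.I))
    (hQb : Q 0 = Complex.exp (b * Complex.I)) (hQd : Q 1 = Complex.exp (d * Complex.I)) :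
    ∃ s t, P s = Q t := by
  by_contra! hne
  have hsc : IsSimplyConnected (univ : Set (ℝ × ℝ)) := by
    exact (Homeomorph.Set.univ (ℝ × ℝ)).toHomotopyEquiv.simplyConnectedSpace
  obtain ⟨f, hf, hfe⟩ := Complex.exists_continuousOn_eqOn_exp_comp hsc isOpen_univ
    (g := fun p : ℝ × ℝ => P p.1 - Q p.2) (by fun_prop) (by
      rintro ⟨p, -, hp⟩
      exact hne _ _ (sub_eq_zero.mp hp))
  have hf' : Continuous f := continuousOn_univ.mp hf
  have hfe' : ∀ s t, Complex.exp (f (s, t)) = P s - Q t := fun s t => hfe (mem_univ (s, t))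
  have n1 : ∀ θ : ℝ, ‖Complex.exp (θ * Complex.I)‖ = 1 := Complex.norm_exp_ofReal_mul_I
  have b1 := mdl_side P hP hP1 (Q 0) (by rw [hQb, n1]) (fun s => hne s 0) (fun s => f (s, 0))
    (by fun_prop) 1 (fun s => by rw [hfe', one_mul])
  have b2 := mdl_side P hP hP1 (Q 1) (by rw [hQd, n1]) (fun s => hne s 1) (fun s => f (s, 1))
    (by fun_prop) 1 (fun s => by rw [hfe', one_mul])
  have b3 := mdl_side Q hQ hQ1 (P 0) (by rw [hPa, n1]) (fun s => (hne 0 s).symm) (fun s => f (0, s))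
    (by fun_prop) (-1) (fun s => by rw [hfe']; ring)
  have b4 := mdl_side Q hQ hQ1 (P 1) (by rw [hPc, n1]) (fun s => (hne 1 s).symm) (fun s => f (1, s))
    (by fun_prop) (-1) (fun s => by rw [hfe']; ring)
  rw [hPa, hPc, hQb, mdl_exp_div, mdl_exp_div] at b1
  rw [hPa, hPc, hQd, mdl_exp_div, mdl_exp_div] at b2
  rw [hPa, hQb, hQd, mdl_exp_div, mdl_exp_div] at b3
  rw [hPc, hQb, hQd, mdl_exp_div, mdl_exp_div] at b4
  have c1 := congrArg Complex.im b1
  have c2 := congrArg Complex.im b2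
  have c3 := congrArg Complex.im b3
  have c4 := congrArg Complex.im b4
  simp only [Complex.sub_im] at c1 c2 c3 c4
  rw [mdl_log_im (c - b) (by linarith) (by linarith), mdl_log_im' (a - b) (by linarith) (by linarith)] at c1
  rw [mdl_log_im' (c - d) (by linarith) (by linarith), mdl_log_im' (a - d) (by linarith) (by linarith)] at c2
  rw [mdl_log_im (d - a) (by linarith) (by linarith), mdl_log_im (b - a) (by linarith) (by linarith)] at c3
  rw [mdl_log_im (d - c) (by linarith) (by linarith), mdl_log_im' (b - c) (by linarith) (by linarith)] at c4
  linarith [Real.pi_pos]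

theorem mdl_planar_data (G : SimpleGraph V) [G.LocallyFinite] (hp : IsPlanar G) (x : V) :
    ∃ q : V → ℂ, (∀ y, G.Adj x y → ‖q y‖ = 1) ∧
      (∀ y y', G.Adj x y → G.Adj x y' → q y = q y' → y = y') ∧
      ∀ y1 y2 y3 y4 w w', G.Adj x y1 → G.Adj x y2 → G.Adj x y3 → G.Adj x y4 →
        y1 ≠ y2 → y1 ≠ y4 → y3 ≠ y2 → y3 ≠ y4 → w ≠ x → w' ≠ x → w ≠ w' →
        w ≠ y2 → w ≠ y4 → w' ≠ y1 → w' ≠ y3 →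
        (w = y1 ∨ G.Adj w y1) → (w = y3 ∨ G.Adj w y3) →
        (w' = y2 ∨ G.Adj w' y2) → (w' = y4 ∨ G.Adj w' y4) →
        ∃ K L : Set ℂ, (∀ z ∈ K, ‖z‖ ≤ 1) ∧ (∀ z ∈ L, ‖z‖ ≤ 1) ∧ (∀ z ∈ K, z ∉ L) ∧
          JoinedIn K (q y1) (q y3) ∧ JoinedIn L (q y2) (q y4) := by
  classical
  obtain ⟨f0, e0, hf0, hc0, hi0, hends0, hv0, hx0⟩ := hp
  let E := Complex.equivRealProdCLM.symm
  have hEi : Function.Injective E := E.injective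
  have hEc : Continuous E := E.continuous
  let f : V → ℂ := fun v => E (f0 v)
  have hf : Function.Injective f := hEi.comp hf0
  let e : ∀ u v : V, G.Adj u v → Set.Icc (0:ℝ) 1 → ℂ := fun u v h t => E (e0 u v h t)
  have hec : ∀ u v h, Continuous (e u v h) := fun u v h => hEc.comp (hc0 u v h)
  have he0 : ∀ u v h, e u v h ⟨0, Set.left_mem_Icc.mpr zero_le_one⟩ = f u := fun u v h => by
    simp only [e, f]; rw [(hends0 u v h).1]
  have he1 : ∀ u v h, e u v h ⟨1, Set.right_mem_Icc.mpr zero_le_one⟩ = f v := fun u v h => by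
    simp only [e, f]; rw [(hends0 u v h).2]
  have hev : ∀ u v (h : G.Adj u v) w t, w ≠ u → w ≠ v → e u v h t ≠ f w := by
    intro u v h w t hu hv heq
    exact hv0 u v h w hu hv ⟨t, hEi heq⟩
  have hee : ∀ u v (h : G.Adj u v) u' v' (h' : G.Adj u' v') t t', ({u, v} : Set V) ≠ {u', v'} →
      e u v h t = e u' v' h' t' → ∃ a, (a = u ∨ a = v) ∧ (a = u' ∨ a = v') ∧ e u v h t = f a := by
    intro u v h u' v' h' t t' hne heq
    have heq' := hEi heq
    have hm := hx0 u v h u' v' h' hne ⟨⟨t, rfl⟩, ⟨t', heq'.symm⟩⟩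
    obtain ⟨⟨a, ha, hfa⟩, ⟨b, hb, hfb⟩⟩ := hm
    have hab : a = b := hf0 (hfa.trans hfb.symm)
    subst hab
    refine ⟨a, by simpa using ha, by simpa using hb, ?_⟩
    simp only [e, f]; rw [hfa]
  -- connecting sets
  let C : V → V → Set ℂ := fun w y => {z | (w = y ∧ z = f y) ∨ ∃ h : G.Adj w y, z ∈ range (e w y h)}
  have hCclosed : ∀ w y, IsClosed (C w y) := by
    intro w y
    by_cases h1 : w = y
    · subst h1
      have : C w w = {f w} := by
        ext z; simp [C]
      rw [this]; exact isClosed_singleton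
    · by_cases h2 : G.Adj w y
      · have : C w y = range (e w y h2) := by
          ext z; simp [C, h1, h2]
        rw [this]
        exact (isCompact_range (hec w y h2)).isClosed
      · have : C w y = ∅ := by
          ext z; simp [C, h1, h2]
        rw [this]; exact isClosed_empty
  have hCpc : ∀ w y, (w = y ∨ G.Adj w y) → IsPathConnected (C w y) ∧ f w ∈ C w y ∧ f y ∈ C w y := by
    intro w y hwy
    by_cases h1 : w = y
    · subst h1
      have : C w w = {f w} := by
        ext z; simp [C]
      rw [this]; exact ⟨isPathConnected_singleton _, rfl, rfl⟩
    · have h2 := hwy.resolve_left h1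
      have : C w y = range (e w y h2) := by
        ext z; simp [C, h1, h2]
      rw [this]
      haveI : PathConnectedSpace (Set.Icc (0:ℝ) 1) := isPathConnected_iff_pathConnectedSpace.mp
        ((convex_Icc (0:ℝ) 1).isPathConnected ⟨0, by simp⟩)
      exact ⟨isPathConnected_range (hec w y h2), ⟨_, he0 w y h2⟩, ⟨_, he1 w y h2⟩⟩
  let J : Set ℂ := ⋃ y ∈ G.neighborFinset x, ⋃ w ∈ (insert y (G.neighborFinset y)).erase x, C w y
  have hJc : IsClosed J := by
    refine Set.Finite.isClosed_biUnion (Finset.finite_toSet _) fun y _ => ?_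
    exact Set.Finite.isClosed_biUnion (Finset.finite_toSet _) fun w _ => hCclosed w y
  have hJx : f x ∉ J := by
    intro hmem
    simp only [J, mem_iUnion] at hmem
    obtain ⟨y, hy, w, hw, hC⟩ := hmem
    have hy' : G.Adj x y := by simpa using hy
    have hwx : w ≠ x := (Finset.mem_erase.mp hw).1
    rcases hC with ⟨_, h⟩ | ⟨h, t, ht⟩
    · exact hy'.ne (hf h)
    · exact hev w y h x t hwx.symm hy'.ne ht
  obtain ⟨r, hr, hball⟩ := Metric.isOpen_iff.mp hJc.isOpen_compl (f x) hJx
  have hCout : ∀ y w, G.Adj x y → w ≠ x → (w = y ∨ G.Adj w y) → ∀ z ∈ C w y, r ≤ ‖z - f x‖ := by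
    intro y w hy hw hwy z hz
    by_contra hlt
    push Not at hlt
    have : z ∈ Jᶜ := hball (by rw [Metric.mem_ball, dist_eq_norm]; exact hlt)
    apply this
    simp only [J, mem_iUnion]
    refine ⟨y, by simpa using hy, w, ?_, hz⟩
    rw [Finset.mem_erase, Finset.mem_insert]
    refine ⟨hw, ?_⟩
    rcases hwy with h | h
    · exact Or.inl h
    · right; simpa using h.symm
  -- tails
  have htail : ∀ y, ∃ (p : ℂ) (T : Set ℂ), G.Adj x y → ‖p - f x‖ = r ∧ p ∈ T ∧ f y ∈ T ∧
      IsPathConnected T ∧ (∀ z ∈ T, r ≤ ‖z - f x‖) ∧ ∀ z ∈ T, ∃ (h : G.Adj x y), ∃ t, z = e x y h t := by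
    intro y
    by_cases hy : G.Adj x y
    swap
    · exact ⟨0, ∅, fun h => absurd h hy⟩
    let g : ℝ → ℂ := Set.IccExtend zero_le_one (e x y hy)
    have hg : Continuous g := (hec x y hy).Icc_extend'
    have hg0 : g 0 = f x := by
      simp only [g]; rw [Set.IccExtend_left]; exact he0 x y hy
    have hg1 : g 1 = f y := by
      simp only [g]; rw [Set.IccExtend_right]; exact he1 x y hy
    have hcl : IsCompact (Icc (0:ℝ) 1 ∩ {t | ‖g t - f x‖ ≤ r}) := by
      apply isCompact_Icc.inter_right
      exact isClosed_le (by fun_prop) continuous_const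
    obtain ⟨t0, ⟨ht0, ht0r⟩, hmax⟩ := hcl.exists_isGreatest ⟨0, by simp, by simp [hg0, hr.le]⟩
    have hfy : r ≤ ‖g 1 - f x‖ := by
      rw [hg1]
      exact hCout y y hy hy.ne' (Or.inl rfl) _ (Or.inl ⟨rfl, rfl⟩)
    have ht0' : ‖g t0 - f x‖ = r := by
      have := intermediate_value_Icc ht0.2 (f := fun t => ‖g t - f x‖) (by fun_prop)
      obtain ⟨t, ht, htr⟩ := this ⟨ht0r, hfy⟩
      have h1 : t ≤ t0 := hmax ⟨⟨ht0.1.trans ht.1, ht.2⟩, le_of_eq htr⟩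
      have h2 : t = t0 := le_antisymm h1 ht.1
      rw [← h2]; exact htr
    refine ⟨g t0, g '' Icc t0 1, fun _ => ⟨ht0', ⟨t0, ⟨le_rfl, ht0.2⟩, rfl⟩,
      ⟨1, ⟨ht0.2, le_rfl⟩, hg1⟩, ?_, ?_, ?_⟩⟩
    · exact ((convex_Icc t0 1).isPathConnected ⟨t0, le_rfl, ht0.2⟩).image hg
    · rintro z ⟨t, ht, rfl⟩
      rcases eq_or_lt_of_le ht.1 with h | h
      · rw [← h, ht0']
      · by_contra hlt
        push Not at hlt
        have := hmax ⟨⟨ht0.1.trans ht.1, ht.2⟩, hlt.le⟩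
        linarith
    · rintro z ⟨t, ht, rfl⟩
      exact ⟨hy, _, rfl⟩
  choose p T hT using htail
  have dTT : ∀ y y', G.Adj x y → G.Adj x y' → y ≠ y' → ∀ z ∈ T y, z ∉ T y' := by
    intro y y' hy hy' hne z hz hz'
    obtain ⟨_, _, _, _, hout, hcur⟩ := hT y hy
    obtain ⟨_, _, _, _, _, hcur'⟩ := hT y' hy'
    obtain ⟨h, t, rfl⟩ := hcur z hz
    obtain ⟨h', t', ht'⟩ := hcur' _ hz'
    obtain ⟨a, ha1, ha2, ha3⟩ := hee x y h x y' h' t t' (by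
      intro heq
      have : y ∈ ({x, y'} : Set V) := heq ▸ (by simp)
      rcases this with h1 | h1
      · exact hy.ne' h1
      · exact hne h1) ht'
    have hax : a = x := by
      rcases ha1 with h1 | h1
      · exact h1
      · rcases ha2 with h2 | h2
        · exact h2
        · exact absurd (h1.symm.trans h2) hne
    have := hout _ hz
    rw [ha3, hax] at this
    simp at this
    linarith
  have dTC : ∀ y y' w', G.Adj x y → G.Adj x y' → y ≠ y' → w' ≠ x → w' ≠ y → ∀ z ∈ T y, z ∉ C w' y' := by
    intro y y' w' hy hy' hne hw' hwy z hz hz'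
    obtain ⟨_, _, _, _, hout, hcur⟩ := hT y hy
    obtain ⟨h, t, rfl⟩ := hcur z hz
    rcases hz' with ⟨_, h2⟩ | ⟨h2, t', ht'⟩
    · exact hev x y h y' t hy'.ne' hne.symm h2
    · obtain ⟨a, ha1, ha2, ha3⟩ := hee x y h w' y' h2 t t' (by
        intro heq
        have : x ∈ ({w', y'} : Set V) := heq ▸ (by simp)
        rcases this with h1 | h1
        · exact hw' h1.symm
        · exact hy'.ne h1) ht'.symm
      rcases ha1 with rfl | rfl
      · rcases ha2 with h3 | h3
        · exact hw' h3.symm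
        · exact hy'.ne h3
      · rcases ha2 with h3 | h3
        · exact hwy h3.symm
        · exact hne h3
  have dCC : ∀ w y w' y', y ≠ y' → w ≠ w' → w ≠ y' → w' ≠ y → ∀ z ∈ C w y, z ∉ C w' y' := by
    intro w y w' y' h1 h2 h3 h4 z hz hz'
    rcases hz with ⟨h5, rfl⟩ | ⟨h5, t, rfl⟩
    · rcases hz' with ⟨_, h6⟩ | ⟨h6, t', ht'⟩
      · exact h1 (hf h6)
      · exact hev w' y' h6 y t' h4.symm h1 ht'
    · rcases hz' with ⟨_, h6⟩ | ⟨h6, t', ht'⟩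
      · exact hev w y h5 y' t h3.symm h1.symm h6
      · obtain ⟨a, ha1, ha2, ha3⟩ := hee w y h5 w' y' h6 t t' (by
          intro heq
          have : w ∈ ({w', y'} : Set V) := heq ▸ (by simp)
          rcases this with h1 | h1
          · exact h2 h1
          · exact h3 h1) ht'.symm
        rcases ha1 with rfl | rfl <;> rcases ha2 with h7 | h7
        · exact h2 h7
        · exact h3 h7
        · exact h4 h7.symm
        · exact h1 h7
  let ψ : ℂ → ℂ := fun z => r / (z - f x)
  have hr0 : (r : ℂ) ≠ 0 := by exact_mod_cast hr.ne'
  have hψi : Function.Injective ψ := by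
    intro a b hab
    simp only [ψ, div_eq_mul_inv] at hab
    have := inv_injective (mul_left_cancel₀ hr0 hab)
    exact sub_left_injective this
  have hψn : ∀ z, r ≤ ‖z - f x‖ → ‖ψ z‖ ≤ 1 := by
    intro z hz
    simp only [ψ]
    rw [norm_div, Complex.norm_real, Real.norm_of_nonneg hr.le, div_le_one (by linarith)]
    exact hz
  have hψc : ∀ K : Set ℂ, (∀ z ∈ K, r ≤ ‖z - f x‖) → ContinuousOn ψ K := by
    intro K hK
    refine continuousOn_const.div (by fun_prop) ?_
    intro z hz h0
    have := hK z hz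
    rw [h0] at this
    simp at this
    linarith
  have hK : ∀ y1 y3 w, G.Adj x y1 → G.Adj x y3 → w ≠ x → (w = y1 ∨ G.Adj w y1) → (w = y3 ∨ G.Adj w y3) →
      IsPathConnected (T y1 ∪ C w y1 ∪ (C w y3 ∪ T y3)) ∧
      ∀ z ∈ (T y1 ∪ C w y1 ∪ (C w y3 ∪ T y3)), r ≤ ‖z - f x‖ := by
    intro y1 y3 w h1 h3 hw hw1 hw3
    obtain ⟨_, _, hf1, hpc1, hout1, _⟩ := hT y1 h1
    obtain ⟨_, _, hf3, hpc3, hout3, _⟩ := hT y3 h3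
    obtain ⟨c1, c2, c3⟩ := hCpc w y1 hw1
    obtain ⟨c4, c5, c6⟩ := hCpc w y3 hw3
    refine ⟨?_, ?_⟩
    · refine IsPathConnected.union (hpc1.union c1 ⟨f y1, hf1, c3⟩) (c4.union hpc3 ⟨f y3, c6, hf3⟩) ?_
      exact ⟨f w, Or.inr c2, Or.inl c5⟩
    · rintro z ((hz | hz) | (hz | hz))
      · exact hout1 z hz
      · exact hCout y1 w h1 hw hw1 z hz
      · exact hCout y3 w h3 hw hw3 z hz
      · exact hout3 z hz
  refine ⟨fun y => ψ (p y), ?_, ?_, ?_⟩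
  · intro y hy
    obtain ⟨h1, _⟩ := hT y hy
    simp only [ψ]
    rw [norm_div, h1, Complex.norm_real, Real.norm_of_nonneg hr.le, div_self hr.ne']
  · intro y y' hy hy' heq
    by_contra hne
    have := hψi heq
    obtain ⟨_, h1, _⟩ := hT y hy
    obtain ⟨_, h2, _⟩ := hT y' hy'
    rw [← this] at h2
    exact dTT y y' hy hy' hne _ h1 h2
  · intro y1 y2 y3 y4 w w' a1 a2 a3 a4 n12 n14 n32 n34 hw hw' hww w2 w4 w1 w3 b1 b3 b2 b4
    obtain ⟨k1, k2⟩ := hK y1 y3 w a1 a3 hw b1 b3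
    obtain ⟨l1, l2⟩ := hK y2 y4 w' a2 a4 hw' b2 b4
    refine ⟨ψ '' (T y1 ∪ C w y1 ∪ (C w y3 ∪ T y3)), ψ '' (T y2 ∪ C w' y2 ∪ (C w' y4 ∪ T y4)),
      ?_, ?_, ?_, ?_, ?_⟩
    · rintro _ ⟨z, hz, rfl⟩
      exact hψn z (k2 z hz)
    · rintro _ ⟨z, hz, rfl⟩
      exact hψn z (l2 z hz)
    · rintro _ ⟨z, hz, rfl⟩ ⟨z', hz', heq⟩
      have := hψi heq
      subst this
      rcases hz with (hz | hz) | (hz | hz) <;> rcases hz' with (hz' | hz') | (hz' | hz')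
      · exact dTT _ _ a1 a2 n12 _ hz hz'
      · exact dTC _ _ _ a1 a2 n12 hw' w1 _ hz hz'
      · exact dTC _ _ _ a1 a4 n14 hw' w1 _ hz hz'
      · exact dTT _ _ a1 a4 n14 _ hz hz'
      · exact dTC _ _ _ a2 a1 n12.symm hw w2 _ hz' hz
      · exact dCC _ _ _ _ n12 hww w2 w1 _ hz hz'
      · exact dCC _ _ _ _ n14 hww w4 w1 _ hz hz'
      · exact dTC _ _ _ a4 a1 n14.symm hw w4 _ hz' hz
      · exact dTC _ _ _ a2 a3 n32.symm hw w2 _ hz' hz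
      · exact dCC _ _ _ _ n32 hww w2 w3 _ hz hz'
      · exact dCC _ _ _ _ n34 hww w4 w3 _ hz hz'
      · exact dTC _ _ _ a4 a3 n34.symm hw w4 _ hz' hz
      · exact dTT _ _ a3 a2 n32 _ hz hz'
      · exact dTC _ _ _ a3 a2 n32 hw' w3 _ hz hz'
      · exact dTC _ _ _ a3 a4 n34 hw' w3 _ hz hz'
      · exact dTT _ _ a3 a4 n34 _ hz hz'
    · refine (k1.image' (hψc _ k2)).joinedIn _ ?_ _ ?_
      · exact ⟨_, Or.inl (Or.inl (hT y1 a1).2.1), rfl⟩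
      · exact ⟨_, Or.inr (Or.inr (hT y3 a3).2.1), rfl⟩
    · refine (l1.image' (hψc _ l2)).joinedIn _ ?_ _ ?_
      · exact ⟨_, Or.inl (Or.inl (hT y2 a2).2.1), rfl⟩
      · exact ⟨_, Or.inr (Or.inr (hT y4 a4).2.1), rfl⟩

theorem mdl_joined_disc (K L : Set ℂ) (hK : ∀ z ∈ K, ‖z‖ ≤ 1) (hL : ∀ z ∈ L, ‖z‖ ≤ 1)
    (hd : ∀ z ∈ K, z ∉ L) (a b c d : ℝ)
    (hab : a < b) (hbc : b < c) (hcd : c < d) (hda : d < a + 2 * Real.pi)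
    (hKj : JoinedIn K (Complex.exp (a * Complex.I)) (Complex.exp (c * Complex.I)))
    (hLj : JoinedIn L (Complex.exp (b * Complex.I)) (Complex.exp (d * Complex.I))) : False := by
  obtain ⟨P, hP⟩ := hKj
  obtain ⟨Q, hQ⟩ := hLj
  have hP' : ∀ s, P.extend s ∈ K := fun s => hP _
  have hQ' : ∀ s, Q.extend s ∈ L := fun s => hQ _
  obtain ⟨s, t, hst⟩ := mdl_disc P.extend Q.extend P.continuous_extend Q.continuous_extend
    (fun s => hK _ (hP' s)) (fun s => hL _ (hQ' s)) a b c d hab hbc hcd hda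
    (by simp) (by simp) (by simp) (by simp)
  exact hd _ (hP' s) (hst ▸ hQ' t)

theorem mdl_cyclic (G : SimpleGraph V) [G.LocallyFinite] (hp : IsPlanar G) (x : V)
    (hD : 0 < G.degree x) :
    ∃ yv : ℤ → V, (∀ i j, yv i = yv j ↔ (G.degree x : ℤ) ∣ i - j) ∧
      (∀ v, G.Adj x v ↔ ∃ i, yv i = v) ∧
      ∀ i j k l : ℤ, i < j → j < k → k < l → l < i + G.degree x → ∀ w w' : V,
        w ≠ x → w' ≠ x → w ≠ w' → w ≠ yv j → w ≠ yv l → w' ≠ yv i → w' ≠ yv k →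
        (w = yv i ∨ G.Adj w (yv i)) → (w = yv k ∨ G.Adj w (yv k)) →
        (w' = yv j ∨ G.Adj w' (yv j)) → (w' = yv l ∨ G.Adj w' (yv l)) → False := by
  classical
  obtain ⟨q, hq1, hqi, hq⟩ := mdl_planar_data G hp x
  set D := G.degree x with hDdef
  let θ : V → ℝ := fun y => Complex.arg (q y)
  have hqθ : ∀ y, G.Adj x y → q y = Complex.exp (θ y * Complex.I) := by
    intro y hy
    have := Complex.norm_mul_exp_arg_mul_I (q y)
    rw [hq1 y hy] at this
    simpa using this.symm
  have hinj : Set.InjOn θ (G.neighborFinset x) := by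
    intro y hy y' hy' heq
    have h1 : G.Adj x y := by simpa using hy
    have h2 : G.Adj x y' := by simpa using hy'
    apply hqi y y' h1 h2
    rw [hqθ y h1, hqθ y' h2, heq]
  have hcard : ((G.neighborFinset x).image θ).card = D := by
    rw [Finset.card_image_of_injOn hinj, G.card_neighborFinset_eq_degree]
  let o := ((G.neighborFinset x).image θ).orderEmbOfFin hcard
  have ho : ∀ m, ∃ y, G.Adj x y ∧ θ y = o m := by
    intro m
    have := Finset.orderEmbOfFin_mem _ hcard m
    obtain ⟨y, hy, hy'⟩ := Finset.mem_image.mp this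
    exact ⟨y, by simpa using hy, hy'⟩
  choose Yv hYadj hYθ using ho
  have hD' : (0:ℤ) < D := by exact_mod_cast hD
  have hlt : ∀ i : ℤ, (i % D).toNat < D := by
    intro i
    have h1 := Int.emod_nonneg i hD'.ne'
    have h2 := Int.emod_lt_of_pos i hD'
    omega
  let m : ℤ → Fin D := fun i => ⟨(i % D).toNat, hlt i⟩
  have hm : ∀ i j, m i = m j ↔ (D : ℤ) ∣ i - j := by
    intro i j
    have h1 := Int.emod_nonneg i hD'.ne'
    have h2 := Int.emod_nonneg j hD'.ne'
    rw [← Int.emod_eq_emod_iff_emod_sub_eq_zero.trans (Int.dvd_iff_emod_eq_zero).symm]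
    simp only [m, Fin.mk.injEq]
    omega
  let Θ : ℤ → ℝ := fun i => o (m i) + 2 * Real.pi * ((i / D : ℤ) : ℝ)
  have hor : ∀ k, -Real.pi < o k ∧ o k ≤ Real.pi := by
    intro k
    rw [← hYθ k]
    exact ⟨Complex.neg_pi_lt_arg _, Complex.arg_le_pi _⟩
  have hΘ : ∀ i j, i < j → Θ i < Θ j := by
    intro i j hij
    have h1 : i / (D:ℤ) ≤ j / D := Int.ediv_le_ediv hD' hij.le
    rcases h1.eq_or_lt with h | h
    · simp only [Θ]
      rw [h]
      have : m i < m j := by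
        simp only [m, Fin.mk_lt_mk]
        have e1 := Int.emod_add_mul_ediv i D
        have e2 := Int.emod_add_mul_ediv j D
        have h3 := Int.emod_nonneg i hD'.ne'
        rw [h] at e1
        omega
      have := o.strictMono this
      linarith
    · simp only [Θ]
      have h2 : ((i / (D:ℤ) : ℤ) : ℝ) + 1 ≤ ((j / (D:ℤ) : ℤ) : ℝ) := by exact_mod_cast h
      have a1 := hor (m i)
      have a2 := hor (m j)
      nlinarith [Real.pi_pos]
  have hΘD : ∀ i, Θ (i + D) = Θ i + 2 * Real.pi := by
    intro i
    have h1 : m (i + D) = m i := by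
      rw [hm]; simp
    have h2 : (i + D) / (D:ℤ) = i / D + 1 := by
      rw [Int.add_ediv_of_dvd_right (dvd_refl _), Int.ediv_self hD'.ne']
    simp only [Θ]
    rw [h1, h2]
    push_cast
    ring
  have hqΘ : ∀ i, q (Yv (m i)) = Complex.exp (Θ i * Complex.I) := by
    intro i
    rw [hqθ _ (hYadj _), hYθ]
    simp only [Θ]
    push_cast
    rw [add_mul, Complex.exp_add]
    have : Complex.exp (2 * Real.pi * ((i / (D:ℤ) : ℤ) : ℂ) * Complex.I) = 1 := by
      rw [Complex.exp_eq_one_iff]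
      exact ⟨i / D, by ring⟩
    rw [this, mul_one]
  have hYinj : ∀ a b, Yv a = Yv b → a = b := by
    intro a b hab
    apply o.injective
    rw [← hYθ, ← hYθ, hab]
  have hne : ∀ i j : ℤ, i < j → j < i + D → Yv (m i) ≠ Yv (m j) := by
    intro i j h1 h2 h3
    have := (hm i j).mp (hYinj _ _ h3)
    have h4 := Int.le_of_dvd (by omega) ((dvd_sub_comm).mp this)
    omega
  refine ⟨fun i => Yv (m i), ?_, ?_, ?_⟩
  · intro i j
    rw [← hm]
    exact ⟨fun h => hYinj _ _ h, fun h => congrArg Yv h⟩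
  · intro v
    constructor
    · intro hv
      have : θ v ∈ Set.range o := by
        rw [Finset.range_orderEmbOfFin]
        exact Finset.mem_coe.mpr (Finset.mem_image_of_mem _ (by simpa using hv))
      obtain ⟨k, hk⟩ := this
      refine ⟨(k.val : ℤ), ?_⟩
      have hmk : m (k.val : ℤ) = k := by
        apply Fin.ext
        simp only [m]
        have : ((k.val : ℤ) % D) = k.val := Int.emod_eq_of_lt (by omega) (by exact_mod_cast k.2)
        rw [this]; simp
      simp only [hmk]
      apply hinj
      · simpa using hYadj k
      · simpa using hv
      · rw [hYθ, hk]
    · rintro ⟨i, rfl⟩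
      exact hYadj _
  · intro i j k l hij hjk hkl hli w w' hw hw' hww w2 w4 w1 w3 b1 b3 b2 b4
    obtain ⟨K, L, hK, hL, hd, hj1, hj2⟩ := hq _ _ _ _ w w' (hYadj (m i)) (hYadj (m j)) (hYadj (m k))
      (hYadj (m l)) (hne i j hij (by omega)) (hne i l (by omega) (by omega))
      (hne j k hjk (by omega)).symm (hne k l hkl (by omega)) hw hw' hww w2 w4 w1 w3 b1 b3 b2 b4
    rw [hqΘ, hqΘ] at hj1 hj2
    refine mdl_joined_disc K L hK hL hd (Θ i) (Θ j) (Θ k) (Θ l) (hΘ _ _ hij) (hΘ _ _ hjk)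
      (hΘ _ _ hkl) ?_ hj1 hj2
    rw [← hΘD]
    exact hΘ _ _ hli

/-- The combinatorial data extracted from planarity and curvature at a vertex `x` of large degree. -/
structure MdlCtx (G : SimpleGraph V) [G.LocallyFinite] (x : V) (yv : ℤ → V) (D : ℤ) : Prop where
  hD : 18 ≤ D
  per : ∀ i j, yv i = yv j ↔ D ∣ i - j
  adj : ∀ v, G.Adj x v ↔ ∃ i, yv i = v
  cross : ∀ i j k l : ℤ, i < j → j < k → k < l → l < i + D → ∀ w w' : V,
        w ≠ x → w' ≠ x → w ≠ w' → w ≠ yv j → w ≠ yv l → w' ≠ yv i → w' ≠ yv k →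
        (w = yv i ∨ G.Adj w (yv i)) → (w = yv k ∨ G.Adj w (yv k)) →
        (w' = yv j ∨ G.Adj w' (yv j)) → (w' = yv l ∨ G.Adj w' (yv l)) → False
  deg : ∀ u, 3 ≤ G.degree u
  star : ∀ (i : ℤ) (S Z M : Finset V) (t : ℕ), 2 + Z.card + M.card ≤ t →
    (∀ u ∈ S, G.Adj (yv i) u ∧ u ≠ x) →
    (∀ z, G.Adj x z → z ≠ yv i → (G.Adj (yv i) z ∨ ∃ u ∈ S, G.Adj u z) → z ∈ Z) →
    (∀ u ∈ S, G.Adj x u → u ∈ M) → 18 * S.card < G.degree (yv i) * t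

namespace MdlCtx

variable {G : SimpleGraph V} [G.LocallyFinite] {x : V} {yv : ℤ → V} {D : ℤ}

theorem adjx (H : MdlCtx G x yv D) (i : ℤ) : G.Adj x (yv i) := (H.adj _).mpr ⟨i, rfl⟩

theorem nex (H : MdlCtx G x yv D) (i : ℤ) : yv i ≠ x := (H.adjx i).ne'

theorem inj (H : MdlCtx G x yv D) {i j : ℤ} (h : yv i = yv j) (h1 : i - j < D) (h2 : j - i < D) :
    i = j := by
  have hd := (H.per i j).mp h
  by_contra hne
  rcases lt_or_gt_of_ne hne with hlt | hlt
  · have := Int.le_of_dvd (by omega) (dvd_sub_comm.mp hd)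
    omega
  · have := Int.le_of_dvd (by omega) hd
    omega

theorem ne (H : MdlCtx G x yv D) {i j : ℤ} (h : i ≠ j) (h1 : i - j < D) (h2 : j - i < D) :
    yv i ≠ yv j := fun he => h (H.inj he h1 h2)

/-- nearby indices give distinct vertices -/
theorem ne' (H : MdlCtx G x yv D) {i j : ℤ} (h : i ≠ j) (h1 : i - j < 18) (h2 : j - i < 18) :
    yv i ≠ yv j := H.ne h (by have := H.hD; omega) (by have := H.hD; omega)

theorem shift (H : MdlCtx G x yv D) (i : ℤ) : yv (i + D) = yv i := by
  rw [H.per]; simp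

theorem rep (H : MdlCtx G x yv D) (b : ℤ) {v : V} (hv : G.Adj x v) :
    ∃ m, b ≤ m ∧ m < b + D ∧ yv m = v := by
  obtain ⟨i, rfl⟩ := (H.adj v).mp hv
  have hD := H.hD
  refine ⟨b + (i - b) % D, ?_, ?_, ?_⟩
  · have := Int.emod_nonneg (i - b) (show D ≠ 0 by omega); omega
  · have := Int.emod_lt_of_pos (i - b) (show 0 < D by omega); omega
  · rw [H.per]
    have h1 := Int.emod_add_mul_ediv (i - b) D
    exact ⟨-((i - b) / D), by linear_combination h1⟩

/-- A vertex `w` attached at `a` and `b` separates. -/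
theorem sep (H : MdlCtx G x yv D) {a c b : ℤ} (hac : a < c) (hcb : c < b) 
    {w : V} (hwx : w ≠ x) (hwa : w = yv a ∨ G.Adj w (yv a)) (hwb : w = yv b ∨ G.Adj w (yv b))
    (hwc : w ≠ yv c) {u : V} (hux : u ≠ x) (huw : u ≠ w) (hua : u ≠ yv a) (hub : u ≠ yv b)
    (huc : u = yv c ∨ G.Adj u (yv c)) {v : V} (hv : G.Adj x v) (huv : u = v ∨ G.Adj u v) :
    v = w ∨ ∃ m, a ≤ m ∧ m ≤ b ∧ yv m = v := by
  obtain ⟨m, h1, h2, rfl⟩ := H.rep a hv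
  by_cases hmb : m ≤ b
  · exact Or.inr ⟨m, h1, hmb, rfl⟩
  · push Not at hmb
    left
    by_contra hne
    exact H.cross a c b m hac hcb hmb h2 w u hwx hux huw.symm hwc (Ne.symm hne) hua hub hwa hwb huc huv

theorem card_N' (H : MdlCtx G x yv D) (i : ℤ) [DecidableEq V] :
    ((G.neighborFinset (yv i)).erase x).card + 1 = G.degree (yv i) := by
  rw [Finset.card_erase_add_one, G.card_neighborFinset_eq_degree]
  simpa using (H.adjx i).symm

theorem mem_N' [DecidableEq V] {i : ℤ} {u : V} :
    u ∈ (G.neighborFinset (yv i)).erase x ↔ G.Adj (yv i) u ∧ u ≠ x := by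
  rw [Finset.mem_erase, SimpleGraph.mem_neighborFinset, and_comm]

/-- the common part of LR: neighbours of the middle vertex. -/
theorem lr_mid (H : MdlCtx G x yv D) {v : V} (hvx : v ≠ x) {i : ℤ} (h1 : G.Adj v (yv (i - 1)))
    (h0 : G.Adj v (yv i)) (h2 : G.Adj v (yv (i + 1))) {u : V} (hux : u ≠ x) (huv : u ≠ v)
    (hu1 : u ≠ yv (i - 1)) (hu2 : u ≠ yv (i + 1)) (hu : u = yv i ∨ G.Adj u (yv i))
    {z : V} (hz : G.Adj x z) (huz : G.Adj u z) :
    z = v ∨ z = yv (i - 1) ∨ z = yv i ∨ z = yv (i + 1) := by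
  have hD := H.hD
  rcases H.sep (a := i - 1) (c := i) (b := i + 1) (by omega) (by omega) hvx (Or.inr h1)
    (Or.inr h2) h0.ne hux huv hu1 hu2 hu hz (Or.inr huz) with h | ⟨m, hm1, hm2, rfl⟩
  · exact Or.inl h
  · have : m = i - 1 ∨ m = i ∨ m = i + 1 := by omega
    rcases this with rfl | rfl | rfl <;> simp

theorem LR (H : MdlCtx G x yv D) {v : V} (hvx : v ≠ x) {i : ℤ} (h1 : G.Adj v (yv (i - 2)))
    (h2 : G.Adj v (yv (i - 1))) (h3 : G.Adj v (yv i)) (h4 : G.Adj v (yv (i + 1)))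
    (h5 : G.Adj v (yv (i + 2))) : False := by
  classical
  have hD := H.hD
  have hk := H.deg (yv i)
  set k := G.degree (yv i) with hkdef
  -- neighbourhoods
  have Ny : ∀ z, G.Adj x z → G.Adj (yv i) z → z = v ∨ z = yv (i - 1) ∨ z = yv (i + 1) := by
    intro z hz hyz
    rcases H.lr_mid hvx h2 h3 h4 (H.nex i) h3.ne' (H.ne' (by omega) (by omega) (by omega))
      (H.ne' (by omega) (by omega) (by omega)) (Or.inl rfl) hz hyz with h | h | h | h
    · tauto
    · tauto
    · exact absurd h hyz.ne'
    · tauto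
  have Np : ∀ z, G.Adj x z → G.Adj (yv (i + 1)) z → z = v ∨ z = yv i ∨ z = yv (i + 2) := by
    intro z hz hyz
    have e1 : i + 1 - 1 = i := by ring
    have e2 : i + 1 + 1 = i + 2 := by ring
    rcases H.lr_mid (i := i + 1) hvx (by rw [e1]; exact h3) h4 (by rw [e2]; exact h5) (H.nex _) h4.ne' (H.ne' (by omega) (by omega) (by omega))
      (H.ne' (by omega) (by omega) (by omega)) (Or.inl rfl) hz hyz with h | h | h | h
    · tauto
    · rw [e1] at h; tauto
    · exact absurd h hyz.ne'
    · rw [e2] at h; tauto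
  have Nm : ∀ z, G.Adj x z → G.Adj (yv (i - 1)) z → z = v ∨ z = yv i ∨ z = yv (i - 2) := by
    intro z hz hyz
    have e1 : i - 1 - 1 = i - 2 := by ring
    have e2 : i - 1 + 1 = i := by ring
    rcases H.lr_mid (i := i - 1) hvx (by rw [e1]; exact h1) h2 (by rw [e2]; exact h3) (H.nex _) h2.ne' (H.ne' (by omega) (by omega) (by omega))
      (H.ne' (by omega) (by omega) (by omega)) (Or.inl rfl) hz hyz with h | h | h | h
    · tauto
    · rw [e1] at h; tauto
    · exact absurd h hyz.ne'
    · rw [e2] at h; tauto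
  have Nu : ∀ u, G.Adj (yv i) u → u ≠ x → u ≠ v → u ≠ yv (i - 1) → u ≠ yv (i + 1) →
      ∀ z, G.Adj x z → G.Adj u z → z = v ∨ z = yv (i - 1) ∨ z = yv i ∨ z = yv (i + 1) := by
    intro u hu hux huv hu1 hu2 z hz huz
    exact H.lr_mid hvx h2 h3 h4 hux huv hu1 hu2 (Or.inr hu.symm) hz huz
  have hvN : v ∈ (G.neighborFinset (yv i)).erase x := mem_N'.mpr ⟨h3.symm, hvx⟩
  set S := ((G.neighborFinset (yv i)).erase x).erase v with hS
  have hSc : S.card + 2 = k := by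
    have := H.card_N' i
    have h' := Finset.card_erase_add_one hvN
    rw [← hS] at h'
    omega
  have hSm : ∀ u ∈ S, G.Adj (yv i) u ∧ u ≠ x ∧ u ≠ v := by
    intro u hu
    obtain ⟨a, b⟩ := Finset.mem_erase.mp hu
    have := mem_N'.mp b
    tauto
  by_cases hp : G.Adj (yv i) (yv (i + 1)) <;> by_cases hm : G.Adj (yv i) (yv (i - 1))
  · -- both
    have hk4 : 2 ≤ S.card := by
      have hsub : ({yv (i + 1), yv (i - 1)} : Finset V) ⊆ S := by
        intro u hu
        simp only [Finset.mem_insert, Finset.mem_singleton] at hu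
        rcases hu with rfl | rfl
        · exact Finset.mem_erase.mpr ⟨h4.ne', mem_N'.mpr ⟨hp, H.nex _⟩⟩
        · exact Finset.mem_erase.mpr ⟨h2.ne', mem_N'.mpr ⟨hm, H.nex _⟩⟩
      have := Finset.card_le_card hsub
      rwa [Finset.card_pair (H.ne' (by omega) (by omega) (by omega))] at this
    have := H.star i S {yv (i - 2), yv (i - 1), yv (i + 1), yv (i + 2), v} {yv (i - 1), yv (i + 1)} 9
      (by
        have a1 : ({yv (i - 2), yv (i - 1), yv (i + 1), yv (i + 2), v} : Finset V).card ≤ 5 := Finset.card_le_five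
        have a2 : ({yv (i - 1), yv (i + 1)} : Finset V).card ≤ 2 := Finset.card_le_two
        omega) (fun u hu => ⟨(hSm u hu).1, (hSm u hu).2.1⟩)
      (by
        intro z hz hzy hzz
        simp only [Finset.mem_insert, Finset.mem_singleton]
        rcases hzz with h | ⟨u, hu, huz⟩
        · have := Ny z hz h; tauto
        · obtain ⟨a1, a2, a3⟩ := hSm u hu
          by_cases u1 : u = yv (i + 1)
          · subst u1; have := Np z hz huz; tauto
          by_cases u2 : u = yv (i - 1)
          · subst u2; have := Nm z hz huz; tauto
          have := Nu u a1 a2 a3 u2 u1 z hz huz; tauto)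
      (by
        intro u hu hux
        simp only [Finset.mem_insert, Finset.mem_singleton]
        obtain ⟨a1, a2, a3⟩ := hSm u hu
        have := Ny u hux a1; tauto)
    omega
  · -- only i + 1
    have := H.star i S {yv (i - 1), yv (i + 1), yv (i + 2), v} {yv (i + 1)} 7
      (by
        have a1 : ({yv (i - 1), yv (i + 1), yv (i + 2), v} : Finset V).card ≤ 4 := Finset.card_le_four
        have a2 : ({yv (i + 1)} : Finset V).card = 1 := Finset.card_singleton _
        omega) (fun u hu => ⟨(hSm u hu).1, (hSm u hu).2.1⟩)
      (by
        intro z hz hzy hzz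
        simp only [Finset.mem_insert, Finset.mem_singleton]
        rcases hzz with h | ⟨u, hu, huz⟩
        · have := Ny z hz h; tauto
        · obtain ⟨a1, a2, a3⟩ := hSm u hu
          by_cases u1 : u = yv (i + 1)
          · subst u1; have := Np z hz huz; tauto
          by_cases u2 : u = yv (i - 1)
          · subst u2; exact absurd a1 hm
          have := Nu u a1 a2 a3 u2 u1 z hz huz; tauto)
      (by
        intro u hu hux
        simp only [Finset.mem_singleton]
        obtain ⟨a1, a2, a3⟩ := hSm u hu
        rcases Ny u hux a1 with h | rfl | h
        · exact absurd h a3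
        · exact absurd a1 hm
        · exact h)
    have := H.star i {yv (i + 1)} {yv (i + 1), yv (i + 2), v} {yv (i + 1)} 6
      (by
        have a1 : ({yv (i + 1), yv (i + 2), v} : Finset V).card ≤ 3 := Finset.card_le_three
        have a2 : ({yv (i + 1)} : Finset V).card = 1 := Finset.card_singleton _
        omega)
      (by intro u hu; rw [Finset.mem_singleton] at hu; subst hu; exact ⟨hp, H.nex _⟩)
      (by
        intro z hz hzy hzz
        simp only [Finset.mem_insert, Finset.mem_singleton] at hzz ⊢
        rcases hzz with h | ⟨u, rfl, huz⟩
        · rcases Ny z hz h with h' | rfl | h'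
          · tauto
          · exact absurd h hm
          · tauto
        · have := Np z hz huz; tauto)
      (by intro u hu _; exact hu)
    rw [Finset.card_singleton] at this
    omega
  · have := H.star i S {yv (i + 1), yv (i - 1), yv (i - 2), v} {yv (i - 1)} 7
      (by
        have a1 : ({yv (i + 1), yv (i - 1), yv (i - 2), v} : Finset V).card ≤ 4 := Finset.card_le_four
        have a2 : ({yv (i - 1)} : Finset V).card = 1 := Finset.card_singleton _
        omega) (fun u hu => ⟨(hSm u hu).1, (hSm u hu).2.1⟩)
      (by
        intro z hz hzy hzz
        simp only [Finset.mem_insert, Finset.mem_singleton]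
        rcases hzz with h | ⟨u, hu, huz⟩
        · have := Ny z hz h; tauto
        · obtain ⟨a1, a2, a3⟩ := hSm u hu
          by_cases u1 : u = yv (i - 1)
          · subst u1; have := Nm z hz huz; tauto
          by_cases u2 : u = yv (i + 1)
          · subst u2; exact absurd a1 hp
          have := Nu u a1 a2 a3 u1 u2 z hz huz; tauto)
      (by
        intro u hu hux
        simp only [Finset.mem_singleton]
        obtain ⟨a1, a2, a3⟩ := hSm u hu
        rcases Ny u hux a1 with h | h | rfl
        · exact absurd h a3
        · exact h
        · exact absurd a1 hp)
    have := H.star i {yv (i - 1)} {yv (i - 1), yv (i - 2), v} {yv (i - 1)} 6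
      (by
        have a1 : ({yv (i - 1), yv (i - 2), v} : Finset V).card ≤ 3 := Finset.card_le_three
        have a2 : ({yv (i - 1)} : Finset V).card = 1 := Finset.card_singleton _
        omega)
      (by intro u hu; rw [Finset.mem_singleton] at hu; subst hu; exact ⟨hm, H.nex _⟩)
      (by
        intro z hz hzy hzz
        simp only [Finset.mem_insert, Finset.mem_singleton] at hzz ⊢
        rcases hzz with h | ⟨u, rfl, huz⟩
        · rcases Ny z hz h with h' | h' | rfl
          · tauto
          · tauto
          · exact absurd h hp
        · have := Nm z hz huz; tauto)
      (by intro u hu _; exact hu)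
    rw [Finset.card_singleton] at this
    omega
  · have := H.star i S {yv (i + 1), yv (i - 1), v} ∅ 5
      (by
        have a1 : ({yv (i + 1), yv (i - 1), v} : Finset V).card ≤ 3 := Finset.card_le_three
        have a2 : (∅ : Finset V).card = 0 := Finset.card_empty
        omega) (fun u hu => ⟨(hSm u hu).1, (hSm u hu).2.1⟩)
      (by
        intro z hz hzy hzz
        simp only [Finset.mem_insert, Finset.mem_singleton]
        rcases hzz with h | ⟨u, hu, huz⟩
        · have := Ny z hz h; tauto
        · obtain ⟨a1, a2, a3⟩ := hSm u hu
          by_cases u1 : u = yv (i - 1)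
          · subst u1; exact absurd a1 hm
          by_cases u2 : u = yv (i + 1)
          · subst u2; exact absurd a1 hp
          have := Nu u a1 a2 a3 u1 u2 z hz huz; tauto)
      (by
        intro u hu hux
        exfalso
        obtain ⟨a1, a2, a3⟩ := hSm u hu
        rcases Ny u hux a1 with h | rfl | rfl
        · exact absurd h a3
        · exact absurd a1 hm
        · exact absurd a1 hp)
    omega

end MdlCtx

namespace MdlCtx

open Classical in
/-- Neighbours of `u` among the neighbours of `x`. -/
noncomputable def NA (G : SimpleGraph V) [G.LocallyFinite] (x u : V) : Finset V :=
  (G.neighborFinset u).filter (fun v => G.Adj x v)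

theorem mem_NA {G : SimpleGraph V} [G.LocallyFinite] {x u v : V} :
    v ∈ NA G x u ↔ G.Adj x v ∧ G.Adj u v := by
  simp [NA, and_comm]

open Classical in
/-- An ear of the cyclic sequence. -/
def Ear (G : SimpleGraph V) [G.LocallyFinite] (x : V) (yv : ℤ → V) (e : ℤ) : Prop :=
  (∀ v, G.Adj x v → (G.Adj (yv e) v ↔ v = yv (e - 1) ∨ v = yv (e + 1))) ∧
  2 ≤ (NA G x (yv (e - 1)) \ {yv e, yv (e + 1)}).card ∧
  2 ≤ (NA G x (yv (e + 1)) \ {yv e, yv (e - 1)}).card ∧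
  7 ≤ ((NA G x (yv (e - 1)) ∪ NA G x (yv (e + 1))) \ {yv (e - 1), yv e, yv (e + 1)}).card

/-- A vertex enclosed by two ears. -/
def Mid (G : SimpleGraph V) [G.LocallyFinite] (x : V) (yv : ℤ → V) (z : ℤ) : Prop :=
  (∀ v, G.Adj x v → (G.Adj (yv z) v ↔
    v = yv (z - 2) ∨ v = yv (z - 1) ∨ v = yv (z + 1) ∨ v = yv (z + 2))) ∧
  Ear G x yv (z - 1) ∧ Ear G x yv (z + 1)

/-- Indices that are neither ears nor mids. -/
def Y2 (G : SimpleGraph V) [G.LocallyFinite] (x : V) (yv : ℤ → V) (a : ℤ) : Prop :=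
  ¬ Ear G x yv a ∧ ¬ Mid G x yv a

/-- Consecutive `Y2` indices. -/
def Link (G : SimpleGraph V) [G.LocallyFinite] (x : V) (yv : ℤ → V) (a b : ℤ) : Prop :=
  b = a + 1 ∨ (b = a + 2 ∧ Ear G x yv (a + 1)) ∨
    (b = a + 4 ∧ Ear G x yv (a + 1) ∧ Mid G x yv (a + 2) ∧ Ear G x yv (a + 3))

variable {G : SimpleGraph V} [G.LocallyFinite] {x : V} {yv : ℤ → V} {D : ℤ}

theorem Ear.nbr {e : ℤ} (h : Ear G x yv e) {v : V} (hv : G.Adj x v) (hev : G.Adj (yv e) v)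
    {a b : ℤ} (ha : a = e - 1) (hb : b = e + 1) : v = yv a ∨ v = yv b := by
  subst ha hb
  exact (h.1 v hv).mp hev

theorem Ear.adj_lo (H : MdlCtx G x yv D) {e : ℤ} (h : Ear G x yv e) {a : ℤ} (ha : a = e - 1) :
    G.Adj (yv e) (yv a) := by
  subst ha
  exact (h.1 _ (H.adjx _)).mpr (Or.inl rfl)

theorem Ear.adj_hi (H : MdlCtx G x yv D) {e : ℤ} (h : Ear G x yv e) {a : ℤ} (ha : a = e + 1) :
    G.Adj (yv e) (yv a) := by
  subst ha
  exact (h.1 _ (H.adjx _)).mpr (Or.inr rfl)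

theorem Ear.hi {e : ℤ} (h : Ear G x yv e) {a b : ℤ} (ha : a = e - 1) (hb : b = e + 1) (t : V)
    (hc : ∀ v, G.Adj x v → G.Adj (yv b) v → v = t ∨ v = yv e ∨ v = yv a) : False := by
  classical
  subst ha hb
  have h3 := h.2.2.1
  have : (NA G x (yv (e + 1)) \ {yv e, yv (e - 1)}) ⊆ {t} := by
    intro v hv
    rw [Finset.mem_sdiff, mem_NA] at hv
    have := hc v hv.1.1 hv.1.2
    have h2 := hv.2
    simp only [Finset.mem_insert, Finset.mem_singleton] at h2 ⊢
    tauto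
  have := Finset.card_le_card this
  rw [Finset.card_singleton] at this
  have h4 : 2 ≤ (NA G x (yv (e + 1)) \ {yv e, yv (e - 1)}).card := by convert h3
  omega

theorem Ear.lo {e : ℤ} (h : Ear G x yv e) {a b : ℤ} (ha : a = e - 1) (hb : b = e + 1) (t : V)
    (hc : ∀ v, G.Adj x v → G.Adj (yv a) v → v = t ∨ v = yv e ∨ v = yv b) : False := by
  classical
  subst ha hb
  have h3 := h.2.1
  have : (NA G x (yv (e - 1)) \ {yv e, yv (e + 1)}) ⊆ {t} := by
    intro v hv
    rw [Finset.mem_sdiff, mem_NA] at hv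
    have := hc v hv.1.1 hv.1.2
    have h2 := hv.2
    simp only [Finset.mem_insert, Finset.mem_singleton] at h2 ⊢
    tauto
  have := Finset.card_le_card this
  rw [Finset.card_singleton] at this
  have h4 : 2 ≤ (NA G x (yv (e - 1)) \ {yv e, yv (e + 1)}).card := by convert h3
  omega

theorem Ear.both {e : ℤ} (h : Ear G x yv e) {a b : ℤ} (ha : a = e - 1) (hb : b = e + 1) (T : Finset V)
    (hT : T.card ≤ 6)
    (hc : ∀ v, G.Adj x v → (G.Adj (yv a) v ∨ G.Adj (yv b) v) →
      v ∈ T ∨ v = yv a ∨ v = yv e ∨ v = yv b) : False := by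
  classical
  subst ha hb
  have h3 := h.2.2.2
  have : ((NA G x (yv (e - 1)) ∪ NA G x (yv (e + 1))) \ {yv (e - 1), yv e, yv (e + 1)}) ⊆ T := by
    intro v hv
    rw [Finset.mem_sdiff, Finset.mem_union, mem_NA, mem_NA] at hv
    have h2 := hv.2
    simp only [Finset.mem_insert, Finset.mem_singleton] at h2
    have := hc v (by tauto) (by tauto)
    tauto
  have := Finset.card_le_card this
  have h4 : 7 ≤ ((NA G x (yv (e - 1)) ∪ NA G x (yv (e + 1))) \ {yv (e - 1), yv e, yv (e + 1)}).card := by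
    convert h3
  omega

theorem Mid.nbr {z : ℤ} (h : Mid G x yv z) {v : V} (hv : G.Adj x v) (hev : G.Adj (yv z) v)
    {a b c d : ℤ} (ha : a = z - 2) (hb : b = z - 1) (hc : c = z + 1) (hd : d = z + 2) :
    v = yv a ∨ v = yv b ∨ v = yv c ∨ v = yv d := by
  subst ha hb hc hd
  exact (h.1 v hv).mp hev

theorem Mid.hi {z : ℤ} (h : Mid G x yv z) {c : ℤ} (hcz : c = z + 2) (T : Finset V) (hT : T.card ≤ 4)
    (hc : ∀ v, G.Adj x v → G.Adj (yv c) v →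
      v ∈ T ∨ v = yv (z - 2) ∨ v = yv (z - 1) ∨ v = yv z ∨ v = yv (z + 1) ∨ v = yv c) : False := by
  classical
  refine h.2.2.both (a := z) (b := c) (by omega) (by omega) (T ∪ {yv (z - 2), yv (z - 1)}) ?_ ?_
  · have h1 := Finset.card_union_le T {yv (z - 2), yv (z - 1)}
    have h2 : ({yv (z - 2), yv (z - 1)} : Finset V).card ≤ 2 := Finset.card_le_two
    omega
  · intro v hv hvv
    simp only [Finset.mem_union, Finset.mem_insert, Finset.mem_singleton]
    rcases hvv with hvv | hvv
    · have := h.nbr hv hvv rfl rfl rfl hcz; tauto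
    · have := hc v hv hvv; tauto

theorem Mid.lo {z : ℤ} (h : Mid G x yv z) {c : ℤ} (hcz : c = z - 2) (T : Finset V) (hT : T.card ≤ 4)
    (hc : ∀ v, G.Adj x v → G.Adj (yv c) v →
      v ∈ T ∨ v = yv (z + 2) ∨ v = yv (z + 1) ∨ v = yv z ∨ v = yv (z - 1) ∨ v = yv c) : False := by
  classical
  refine h.2.1.both (a := c) (b := z) (by omega) (by omega) (T ∪ {yv (z + 2), yv (z + 1)}) ?_ ?_
  · have h1 := Finset.card_union_le T {yv (z + 2), yv (z + 1)}
    have h2 : ({yv (z + 2), yv (z + 1)} : Finset V).card ≤ 2 := Finset.card_le_two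
    omega
  · intro v hv hvv
    simp only [Finset.mem_union, Finset.mem_insert, Finset.mem_singleton]
    rcases hvv with hvv | hvv
    · have := hc v hv hvv; tauto
    · have := h.nbr hv hvv hcz rfl rfl rfl; tauto

theorem Ear.not_adj {e : ℤ} (h : Ear G x yv e) {e' : ℤ} (he : e' = e + 1) : ¬ Ear G x yv e' := by
  intro h'
  refine h.hi (a := e - 1) (b := e') rfl he (yv (e + 2)) ?_
  intro v hv hvv
  have := h'.nbr hv hvv (a := e) (b := e + 2) (by omega) (by omega)
  tauto

theorem Mid.hi_Y2 {z : ℤ} (h : Mid G x yv z) {c : ℤ} (hc : c = z + 2) : Y2 G x yv c := by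
  classical
  constructor
  · intro h'
    exact h.2.2.not_adj (by omega) h'
  · intro h'
    refine h.hi hc {yv (z + 3), yv (z + 4)} (Finset.card_le_two.trans (by norm_num)) ?_
    intro v hv hvv
    have := h'.nbr hv hvv (a := z) (b := z + 1) (c := z + 3) (d := z + 4) (by omega) (by omega) (by omega) (by omega)
    simp only [Finset.mem_insert, Finset.mem_singleton]
    tauto

theorem Mid.lo_Y2 {z : ℤ} (h : Mid G x yv z) {c : ℤ} (hc : c = z - 2) : Y2 G x yv c := by
  classical
  constructor
  · intro h'
    exact h'.not_adj (by omega) h.2.1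
  · intro h'
    refine h.lo hc {yv (z - 3), yv (z - 4)} (Finset.card_le_two.trans (by norm_num)) ?_
    intro v hv hvv
    have := h'.nbr hv hvv (a := z - 4) (b := z - 3) (c := z - 1) (d := z) (by omega) (by omega) (by omega) (by omega)
    simp only [Finset.mem_insert, Finset.mem_singleton]
    tauto

theorem exists_succ {a : ℤ} (h : Y2 G x yv a) : ∃ b, Link G x yv a b ∧ Y2 G x yv b := by
  by_cases h1 : Ear G x yv (a + 1)
  · by_cases h2 : Mid G x yv (a + 2)
    · refine ⟨a + 4, Or.inr (Or.inr ⟨rfl, h1, h2, ?_⟩), h2.hi_Y2 (by ring)⟩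
      have := h2.2.2
      rwa [show a + 2 + 1 = a + 3 by ring] at this
    · exact ⟨a + 2, Or.inr (Or.inl ⟨rfl, h1⟩), h1.not_adj (by ring), h2⟩
  · refine ⟨a + 1, Or.inl rfl, h1, ?_⟩
    intro h2
    have := h2.2.1
    rw [show a + 1 - 1 = a by ring] at this
    exact h.1 this

theorem exists_pred {a : ℤ} (h : Y2 G x yv a) : ∃ b, Link G x yv b a ∧ Y2 G x yv b := by
  by_cases h1 : Ear G x yv (a - 1)
  · by_cases h2 : Mid G x yv (a - 2)
    · refine ⟨a - 4, Or.inr (Or.inr ⟨by ring, ?_, ?_, ?_⟩), h2.lo_Y2 (by ring)⟩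
      · have := h2.2.1
        rwa [show a - 2 - 1 = a - 4 + 1 by ring] at this
      · rwa [show a - 4 + 2 = a - 2 by ring]
      · rwa [show a - 4 + 3 = a - 1 by ring]
    · exact ⟨a - 2, Or.inr (Or.inl ⟨by ring, by rwa [show a - 2 + 1 = a - 1 by ring]⟩),
        fun h' => h'.not_adj (by ring) h1, h2⟩
  · refine ⟨a - 1, Or.inl (by ring), h1, ?_⟩
    intro h2
    have := h2.2.2
    rw [show a - 1 + 1 = a by ring] at this
    exact h.1 this

theorem Link.lt {a b : ℤ} (h : Link G x yv a b) : a < b ∧ b ≤ a + 4 := by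
  rcases h with h | ⟨h, _⟩ | ⟨h, _⟩ <;> omega

theorem Link.no_between {a b : ℤ} (h : Link G x yv a b) {c : ℤ} (hc : Y2 G x yv c) (h1 : a < c)
    (h2 : c < b) : False := by
  rcases h with h | ⟨h, h3⟩ | ⟨h, h3, h4, h5⟩
  · omega
  · have : c = a + 1 := by omega
    subst this; exact hc.1 h3
  · have : c = a + 1 ∨ c = a + 2 ∨ c = a + 3 := by omega
    rcases this with rfl | rfl | rfl
    · exact hc.1 h3
    · exact hc.2 h4
    · exact hc.1 h5

theorem conf_link {a c b : ℤ} (h1 : Link G x yv a c) (h2 : Link G x yv c b)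
    (hc : ∀ v, G.Adj x v → G.Adj (yv c) v → ∃ m, a ≤ m ∧ m ≤ b ∧ yv m = v) :
    (a = c - 1 ∧ b = c + 1) ∨
      (a = c - 2 ∧ b = c + 2 ∧ Ear G x yv (c - 1) ∧ Ear G x yv (c + 1)) := by
  classical
  have lb := h2.lt
  have la := h1.lt
  -- left mid
  have L3 : ∀ z, c = z + 2 → a = z - 2 → ¬ Mid G x yv z := by
    intro z hz ha hm
    refine hm.hi hz {yv (c + 1), yv (c + 2), yv (c + 3), yv (c + 4)} Finset.card_le_four ?_
    intro v hv hvv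
    obtain ⟨m, m1, m2, rfl⟩ := hc v hv hvv
    have : m = c + 1 ∨ m = c + 2 ∨ m = c + 3 ∨ m = c + 4 ∨ m = z - 2 ∨ m = z - 1 ∨ m = z ∨ m = z + 1 ∨ m = c := by
      omega
    simp only [Finset.mem_insert, Finset.mem_singleton]
    rcases this with h | h | h | h | h | h | h | h | h <;> rw [h] <;> tauto
  have R3 : ∀ z, c = z - 2 → b = z + 2 → ¬ Mid G x yv z := by
    intro z hz ha hm
    refine hm.lo hz {yv (c - 1), yv (c - 2), yv (c - 3), yv (c - 4)} Finset.card_le_four ?_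
    intro v hv hvv
    obtain ⟨m, m1, m2, rfl⟩ := hc v hv hvv
    have : m = c - 1 ∨ m = c - 2 ∨ m = c - 3 ∨ m = c - 4 ∨ m = z + 2 ∨ m = z + 1 ∨ m = z ∨ m = z - 1 ∨ m = c := by
      omega
    simp only [Finset.mem_insert, Finset.mem_singleton]
    rcases this with h | h | h | h | h | h | h | h | h <;> rw [h] <;> tauto
  rcases h1 with h1 | ⟨h1, e1⟩ | ⟨h1, _, e1, _⟩
  · rcases h2 with h2 | ⟨h2, e2⟩ | ⟨h2, _, e2, _⟩
    · left; omega
    · exfalso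
      refine e2.lo (a := c) (b := c + 2) (by omega) (by omega) (yv (c - 1)) ?_
      intro v hv hvv
      obtain ⟨m, m1, m2, rfl⟩ := hc v hv hvv
      have hmc : m ≠ c := by rintro rfl; exact hvv.ne rfl
      have : m = c - 1 ∨ m = c + 1 ∨ m = c + 2 := by omega
      rcases this with h | h | h <;> rw [h] <;> tauto
    · exact absurd e2 (R3 (c + 2) (by omega) (by omega))
  · rcases h2 with h2 | ⟨h2, e2⟩ | ⟨h2, _, e2, _⟩
    · exfalso
      refine e1.hi (a := a) (b := c) (by omega) (by omega) (yv (c + 1)) ?_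
      intro v hv hvv
      obtain ⟨m, m1, m2, rfl⟩ := hc v hv hvv
      have hmc : m ≠ c := by rintro rfl; exact hvv.ne rfl
      have : m = c + 1 ∨ m = a + 1 ∨ m = a := by omega
      rcases this with h | h | h <;> rw [h] <;> tauto
    · right
      refine ⟨by omega, by omega, ?_, e2⟩
      rwa [show c - 1 = a + 1 by omega]
    · exact absurd e2 (R3 (c + 2) (by omega) (by omega))
  · exact absurd e1 (L3 (a + 2) (by omega) (by omega))

end MdlCtx

namespace MdlCtx

variable {G : SimpleGraph V} [G.LocallyFinite] {x : V} {yv : ℤ → V} {D : ℤ}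

theorem card_two_erase [DecidableEq V] (s : Finset V) {a b : V} (hab : a ≠ b) :
    s.card ≤ ((s.erase a).erase b).card + 2 ∧
      (s.card = ((s.erase a).erase b).card + 2 → a ∈ s ∧ b ∈ s) := by
  by_cases ha : a ∈ s <;> by_cases hb : b ∈ s
  · have h1 := Finset.card_erase_add_one ha
    have h2 := Finset.card_erase_add_one (Finset.mem_erase.mpr ⟨hab.symm, hb⟩)
    exact ⟨by omega, fun _ => ⟨ha, hb⟩⟩
  · have h1 := Finset.card_erase_add_one ha
    rw [Finset.erase_eq_of_notMem (s := s.erase a) (fun h => hb (Finset.mem_erase.mp h).2)]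
    exact ⟨by omega, fun _ => by omega⟩
  · rw [Finset.erase_eq_of_notMem ha]
    have h1 := Finset.card_erase_add_one hb
    exact ⟨by omega, fun _ => by omega⟩
  · rw [Finset.erase_eq_of_notMem ha, Finset.erase_eq_of_notMem hb]
    exact ⟨by omega, fun _ => by omega⟩

/-- The case without ears of the pocket lemma: the vertex is itself an ear. -/
theorem pocket_ear (H : MdlCtx G x yv D) {c : ℤ}
    (hc : ∀ v, G.Adj x v → G.Adj (yv c) v → v = yv (c - 1) ∨ v = yv (c + 1)) (w : V)
    (hu : ∀ u, G.Adj (yv c) u → u ≠ x → u ≠ yv (c - 1) → u ≠ yv (c + 1) → ∀ v, G.Adj x v →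
      G.Adj u v → v = w ∨ v = yv (c - 1) ∨ v = yv c ∨ v = yv (c + 1)) : Ear G x yv c := by
  classical
  have hD := H.hD
  have hk := H.deg (yv c)
  have hab : yv (c - 1) ≠ yv (c + 1) := H.ne' (by omega) (by omega) (by omega)
  have hac : yv (c - 1) ≠ yv c := H.ne' (by omega) (by omega) (by omega)
  have hbc : yv (c + 1) ≠ yv c := H.ne' (by omega) (by omega) (by omega)
  have hax := H.nex (c - 1)
  have hbx := H.nex (c + 1)
  obtain ⟨a, ha⟩ : ∃ a, a = yv (c - 1) := ⟨_, rfl⟩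
  obtain ⟨b, hb⟩ : ∃ b, b = yv (c + 1) := ⟨_, rfl⟩
  unfold Ear
  simp only [← ha, ← hb] at hc hu hab hac hbc hax hbx ⊢
  clear ha hb
  set S0 := (((G.neighborFinset (yv c)).erase x).erase a).erase b with hS0
  have hcard := H.card_N' c
  obtain ⟨hc1, hc2⟩ := card_two_erase ((G.neighborFinset (yv c)).erase x) hab
  rw [← hS0] at hc1 hc2
  have hSm : ∀ u ∈ S0, G.Adj (yv c) u ∧ u ≠ x ∧ u ≠ a ∧ u ≠ b := by
    intro u h
    obtain ⟨h1, h2⟩ := Finset.mem_erase.mp h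
    obtain ⟨h3, h4⟩ := Finset.mem_erase.mp h2
    have := mem_N'.mp h4
    tauto
  have hSY : ∀ u ∈ S0, ¬ G.Adj x u := by
    intro u h hxu
    obtain ⟨h1, h2, h3, h4⟩ := hSm u h
    rcases hc u hxu h1 with h' | h'
    · exact h3 h'
    · exact h4 h'
  have s1 := H.star c S0 {a, b, w} ∅ 5
    (by
      have a1 : ({a, b, w} : Finset V).card ≤ 3 := Finset.card_le_three
      have a2 : (∅ : Finset V).card = 0 := Finset.card_empty
      omega)
    (fun u h => ⟨(hSm u h).1, (hSm u h).2.1⟩)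
    (by
      intro z hz hzc hzz
      simp only [Finset.mem_insert, Finset.mem_singleton]
      rcases hzz with h | ⟨u, h, huz⟩
      · have := hc z hz h; tauto
      · obtain ⟨h1, h2, h3, h4⟩ := hSm u h
        have := hu u h1 h2 h3 h4 z hz huz
        tauto)
    (fun u h hx => absurd hx (hSY u h))
  obtain ⟨W, hWc, hW⟩ : ∃ W : Finset V, W.card ≤ S0.card ∧ (∀ u ∈ S0, w ∈ W) := by
    rcases S0.eq_empty_or_nonempty with h | h
    · exact ⟨∅, by simp, by simp [h]⟩
    · exact ⟨{w}, by simpa using h.card_pos, by simp⟩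
  have hk34 : (G.degree (yv c) = 3 ∧ S0.card = 0) ∨ (G.degree (yv c) = 4 ∧ S0.card = 1) := by
    omega
  obtain ⟨haN, hbN⟩ := hc2 (by omega)
  have haN' := mem_N'.mp haN
  have hbN' := mem_N'.mp hbN
  have haS : a ∉ S0 := fun h => (hSm a h).2.2.1 rfl
  have hbS : b ∉ S0 := fun h => (hSm b h).2.2.2 rfl
  have hbS' : b ∉ S0 := hbS
  -- one side
  have one : ∀ p q : V, p ≠ q → (p = a ∧ q = b ∨ p = b ∧ q = a) → 2 ≤ (NA G x p \ {yv c, q}).card := by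
    intro p q hpq hor
    have hpS : p ∉ S0 := by rcases hor with ⟨rfl, rfl⟩ | ⟨rfl, rfl⟩ <;> assumption
    have hpa : G.Adj (yv c) p ∧ p ≠ x := by rcases hor with ⟨rfl, rfl⟩ | ⟨rfl, rfl⟩ <;> assumption
    have hsets : ∀ z, (z = a ∨ z = b) ↔ (z = p ∨ z = q) := by
      intro z; rcases hor with ⟨rfl, rfl⟩ | ⟨rfl, rfl⟩ <;> tauto
    have := H.star c (insert p S0) ((NA G x p \ {yv c, q}) ∪ ({p, q} ∪ W)) {p}
      (2 + ((NA G x p \ {yv c, q}).card + (2 + S0.card)) + 1)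
      (by
        have a1 := Finset.card_union_le (NA G x p \ {yv c, q}) ({p, q} ∪ W)
        have a2 := Finset.card_union_le ({p, q} : Finset V) W
        have a3 : ({p, q} : Finset V).card ≤ 2 := Finset.card_le_two
        have a4 : ({p} : Finset V).card = 1 := Finset.card_singleton _
        omega)
      (by
        intro u h
        rcases Finset.mem_insert.mp h with rfl | h
        · exact hpa
        · exact ⟨(hSm u h).1, (hSm u h).2.1⟩)
      (by
        intro z hz hzc hzz
        by_cases hzq : z = p ∨ z = q
        · exact Finset.mem_union_right _ (Finset.mem_union_left _ (by simpa using hzq))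
        · rcases hzz with h | ⟨u, h, huz⟩
          · exact absurd ((hsets z).mp (hc z hz h)) hzq
          · rcases Finset.mem_insert.mp h with rfl | h
            · refine Finset.mem_union_left _ (Finset.mem_sdiff.mpr ⟨mem_NA.mpr ⟨hz, huz⟩, ?_⟩)
              simp only [Finset.mem_insert, Finset.mem_singleton]
              exact fun h' => h'.elim hzc (fun h' => hzq (Or.inr h'))
            · obtain ⟨h1, h2, h3, h4⟩ := hSm u h
              rcases hu u h1 h2 h3 h4 z hz huz with h5 | h5 | h5 | h5
              · rw [h5]; exact Finset.mem_union_right _ (Finset.mem_union_right _ (hW u h))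
              · exact absurd ((hsets z).mp (Or.inl h5)) hzq
              · exact absurd h5 hzc
              · exact absurd ((hsets z).mp (Or.inr h5)) hzq)
      (by
        intro u h hx
        rcases Finset.mem_insert.mp h with rfl | h
        · simp
        · exact absurd hx (hSY u h))
    rw [Finset.card_insert_of_notMem hpS] at this
    rcases hk34 with ⟨h1, h2⟩ | ⟨h1, h2⟩ <;> rw [h1, h2] at this <;> omega
  have two : 7 ≤ ((NA G x a ∪ NA G x b) \ {a, yv c, b}).card := by
    have haS' : a ∉ insert b S0 := by
      intro h
      rcases Finset.mem_insert.mp h with h | h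
      · exact hab h
      · exact haS h
    have := H.star c (insert a (insert b S0)) (((NA G x a ∪ NA G x b) \ {a, yv c, b}) ∪ ({a, b} ∪ W)) {a, b}
      (2 + (((NA G x a ∪ NA G x b) \ {a, yv c, b}).card + (2 + S0.card)) + 2)
      (by
        have a1 := Finset.card_union_le ((NA G x a ∪ NA G x b) \ {a, yv c, b}) ({a, b} ∪ W)
        have a2 := Finset.card_union_le ({a, b} : Finset V) W
        have a3 : ({a, b} : Finset V).card ≤ 2 := Finset.card_le_two
        omega)
      (by
        intro u h
        rcases Finset.mem_insert.mp h with rfl | h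
        · exact haN'
        rcases Finset.mem_insert.mp h with rfl | h
        · exact hbN'
        · exact ⟨(hSm u h).1, (hSm u h).2.1⟩)
      (by
        intro z hz hzc hzz
        by_cases hzq : z = a ∨ z = b
        · exact Finset.mem_union_right _ (Finset.mem_union_left _ (by simpa using hzq))
        · have hzn : z ∉ ({a, yv c, b} : Finset V) := by
            simp only [Finset.mem_insert, Finset.mem_singleton]
            exact fun h' => h'.elim (fun h' => hzq (Or.inl h'))
              (fun h' => h'.elim hzc (fun h' => hzq (Or.inr h')))
          rcases hzz with h | ⟨u, h, huz⟩
          · exact absurd (hc z hz h) hzq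
          · rcases Finset.mem_insert.mp h with rfl | h
            · exact Finset.mem_union_left _ (Finset.mem_sdiff.mpr
                ⟨Finset.mem_union_left _ (mem_NA.mpr ⟨hz, huz⟩), hzn⟩)
            rcases Finset.mem_insert.mp h with rfl | h
            · exact Finset.mem_union_left _ (Finset.mem_sdiff.mpr
                ⟨Finset.mem_union_right _ (mem_NA.mpr ⟨hz, huz⟩), hzn⟩)
            · obtain ⟨h1, h2, h3, h4⟩ := hSm u h
              rcases hu u h1 h2 h3 h4 z hz huz with h5 | h5 | h5 | h5
              · rw [h5]; exact Finset.mem_union_right _ (Finset.mem_union_right _ (hW u h))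
              · exact absurd (Or.inl h5) hzq
              · exact absurd h5 hzc
              · exact absurd (Or.inr h5) hzq)
      (by
        intro u h hx
        rcases Finset.mem_insert.mp h with rfl | h
        · simp
        rcases Finset.mem_insert.mp h with rfl | h
        · simp
        · exact absurd hx (hSY u h))
    rw [Finset.card_insert_of_notMem haS', Finset.card_insert_of_notMem hbS] at this
    rcases hk34 with ⟨h1, h2⟩ | ⟨h1, h2⟩ <;> rw [h1, h2] at this <;> omega
  have o1 := one a b hab (Or.inl ⟨rfl, rfl⟩)
  have o2 := one b a hab.symm (Or.inr ⟨rfl, rfl⟩)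
  refine ⟨?_, ?_, ?_, ?_⟩
  · intro v hv
    constructor
    · exact hc v hv
    · rintro (rfl | rfl)
      · exact haN'.1
      · exact hbN'.1
  · convert o1
  · convert o2
  · convert two

/-- The pocket lemma. -/
theorem pocket (H : MdlCtx G x yv D) {a c b : ℤ} (hY : Y2 G x yv c) (h1 : Link G x yv a c)
    (h2 : Link G x yv c b)
    (hc : ∀ v, G.Adj x v → G.Adj (yv c) v → ∃ m, a ≤ m ∧ m ≤ b ∧ yv m = v) (w : V)
    (hu : ∀ u, G.Adj (yv c) u → u ≠ x → u ≠ yv a → u ≠ yv b → ∀ v, G.Adj x v →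
      G.Adj u v → v = w ∨ ∃ m, a ≤ m ∧ m ≤ b ∧ yv m = v) : False := by
  classical
  have hk := H.deg (yv c)
  rcases conf_link h1 h2 hc with ⟨rfl, rfl⟩ | ⟨rfl, rfl, e1, e2⟩
  · apply hY.1
    refine H.pocket_ear ?_ w ?_
    · intro v hv hvv
      obtain ⟨m, m1, m2, rfl⟩ := hc v hv hvv
      have hmc : m ≠ c := by rintro rfl; exact hvv.ne rfl
      have : m = c - 1 ∨ m = c + 1 := by omega
      rcases this with h | h <;> rw [h] <;> simp
    · intro u q1 q2 q3 q4 v hv huv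
      rcases hu u q1 q2 q3 q4 v hv huv with h | ⟨m, m1, m2, rfl⟩
      · exact Or.inl h
      · right
        have : m = c - 1 ∨ m = c ∨ m = c + 1 := by omega
        rcases this with h | h | h <;> rw [h] <;> simp
  · apply hY.2
    have hab : yv (c - 2) ≠ yv (c + 2) := H.ne' (by omega) (by omega) (by omega)
    have hee : yv (c - 1) ≠ yv (c + 1) := H.ne' (by omega) (by omega) (by omega)
    set S0 := (((G.neighborFinset (yv c)).erase x).erase (yv (c - 2))).erase (yv (c + 2)) with hS0
    have hcard := H.card_N' c
    obtain ⟨hc1, hc2⟩ := card_two_erase ((G.neighborFinset (yv c)).erase x) hab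
    rw [← hS0] at hc1 hc2
    have hSm : ∀ u, u ∈ S0 ↔ G.Adj (yv c) u ∧ u ≠ x ∧ u ≠ yv (c - 2) ∧ u ≠ yv (c + 2) := by
      intro u
      rw [hS0, Finset.mem_erase, Finset.mem_erase, mem_N']
      tauto
    have hA : ∀ v, G.Adj x v → G.Adj (yv c) v →
        v = yv (c - 2) ∨ v = yv (c - 1) ∨ v = yv (c + 1) ∨ v = yv (c + 2) := by
      intro v hv hvv
      obtain ⟨m, m1, m2, rfl⟩ := hc v hv hvv
      have hmc : m ≠ c := by rintro rfl; exact hvv.ne rfl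
      have : m = c - 2 ∨ m = c - 1 ∨ m = c + 1 ∨ m = c + 2 := by omega
      rcases this with h | h | h | h <;> rw [h] <;> simp
    have ae1 : G.Adj (yv c) (yv (c - 1)) := (e1.adj_hi H (by omega)).symm
    have ae2 : G.Adj (yv c) (yv (c + 1)) := (e2.adj_lo H (by omega)).symm
    have hs2 : 2 ≤ S0.card := by
      have hsub : ({yv (c - 1), yv (c + 1)} : Finset V) ⊆ S0 := by
        intro u hu
        simp only [Finset.mem_insert, Finset.mem_singleton] at hu
        rw [hSm]
        rcases hu with rfl | rfl
        · exact ⟨ae1, H.nex _, H.ne' (by omega) (by omega) (by omega), H.ne' (by omega) (by omega) (by omega)⟩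
        · exact ⟨ae2, H.nex _, H.ne' (by omega) (by omega) (by omega), H.ne' (by omega) (by omega) (by omega)⟩
      have := Finset.card_le_card hsub
      rwa [Finset.card_pair hee] at this
    have s1 := H.star c S0 {yv (c - 2), yv (c - 1), yv (c + 1), yv (c + 2), w} {yv (c - 1), yv (c + 1)} 9
      (by
        have a1 : ({yv (c - 2), yv (c - 1), yv (c + 1), yv (c + 2), w} : Finset V).card ≤ 5 := Finset.card_le_five
        have a2 : ({yv (c - 1), yv (c + 1)} : Finset V).card ≤ 2 := Finset.card_le_two
        omega)
      (fun u h => ⟨((hSm u).mp h).1, ((hSm u).mp h).2.1⟩)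
      (by
        intro z hz hzc hzz
        simp only [Finset.mem_insert, Finset.mem_singleton]
        rcases hzz with h | ⟨u, h, huz⟩
        · rcases hA z hz h with h | h | h | h <;> simp [h]
        · obtain ⟨q1, q2, q3, q4⟩ := (hSm u).mp h
          rcases hu u q1 q2 q3 q4 z hz huz with h5 | ⟨m, m1, m2, rfl⟩
          · simp [h5]
          · have hmc : m ≠ c := by rintro rfl; exact hzc rfl
            have : m = c - 2 ∨ m = c - 1 ∨ m = c + 1 ∨ m = c + 2 := by omega
            rcases this with h | h | h | h <;> rw [h] <;> simp)
      (by
        intro u h hx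
        obtain ⟨q1, q2, q3, q4⟩ := (hSm u).mp h
        simp only [Finset.mem_insert, Finset.mem_singleton]
        rcases hA u hx q1 with h | h | h | h
        · exact absurd h q3
        · exact Or.inl h
        · exact Or.inr h
        · exact absurd h q4)
    obtain ⟨aN, bN⟩ := hc2 (by omega)
    refine ⟨?_, e1, e2⟩
    intro v hv
    refine ⟨hA v hv, ?_⟩
    rintro (rfl | rfl | rfl | rfl)
    · exact (mem_N'.mp aN).1
    · exact ae1
    · exact ae2
    · exact (mem_N'.mp bN).1

end MdlCtx

namespace MdlCtx

variable {G : SimpleGraph V} [G.LocallyFinite] {x : V} {yv : ℤ → V} {D : ℤ}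

theorem shift' (H : MdlCtx G x yv D) {i j : ℤ} (h : i = j + D) : yv i = yv j := by
  rw [h, H.shift]

theorem Ear.shift (H : MdlCtx G x yv D) {e : ℤ} : Ear G x yv (e + D) ↔ Ear G x yv e := by
  unfold Ear
  rw [H.shift, H.shift' (show e + D - 1 = e - 1 + D by ring),
    H.shift' (show e + D + 1 = e + 1 + D by ring)]

theorem Y2.shift (H : MdlCtx G x yv D) {e : ℤ} : Y2 G x yv (e + D) ↔ Y2 G x yv e := by
  unfold Y2 Mid
  rw [Ear.shift H, H.shift, H.shift' (show e + D - 1 = e - 1 + D by ring),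
    H.shift' (show e + D + 1 = e + 1 + D by ring), H.shift' (show e + D - 2 = e - 2 + D by ring),
    H.shift' (show e + D + 2 = e + 2 + D by ring), show e + D - 1 = e - 1 + D by ring,
    show e + D + 1 = e + 1 + D by ring, Ear.shift H, Ear.shift H]

/-- `w` is attached at index `i`. -/
def At (G : SimpleGraph V) (yv : ℤ → V) (w : V) (i : ℤ) : Prop := w = yv i ∨ G.Adj w (yv i)

theorem At.shift (H : MdlCtx G x yv D) {w : V} {i : ℤ} (h : At G yv w i) : At G yv w (i + D) := by
  unfold At; rwa [H.shift]

/-- A bad interval. -/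
def Bad (G : SimpleGraph V) [G.LocallyFinite] (x : V) (yv : ℤ → V) (D : ℤ) (p q : ℤ) (w : V) : Prop :=
  p < q ∧ q < p + D ∧ w ≠ x ∧ Y2 G x yv p ∧ Y2 G x yv q ∧ At G yv w p ∧ At G yv w q ∧
    ∃ c, p < c ∧ c < q ∧ Y2 G x yv c ∧ ¬ At G yv w c

/-- No bad interval: everything is `Y2`. -/
theorem all_Y2 (H : MdlCtx G x yv D) (hb : ∀ p q w, ¬ Bad G x yv D p q w) (i : ℤ) :
    Y2 G x yv i := by
  have hD := H.hD
  have hmid : ∀ z, ¬ Mid G x yv z := by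
    intro z hz
    have y1 : Y2 G x yv (z + 2) := hz.hi_Y2 rfl
    have y2 : Y2 G x yv (z - 2) := hz.lo_Y2 rfl
    obtain ⟨c, hl, hc⟩ := exists_succ y1
    have := hl.lt
    refine hb (z + 2) (z - 2 + D) (yv z) ⟨by omega, by omega, H.nex _, y1, (Y2.shift H).mpr y2,
      Or.inr ((hz.1 _ (H.adjx _)).mpr (by tauto)), At.shift H (Or.inr ((hz.1 _ (H.adjx _)).mpr (by tauto))),
      c, by omega, by omega, hc, ?_⟩
    rintro (h | h)
    · exact H.ne' (i := z) (j := c) (by omega) (by omega) (by omega) h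
    · rcases hz.nbr (H.adjx c) h rfl rfl rfl rfl with h | h | h | h <;>
        exact H.ne' (by omega) (by omega) (by omega) h
  have hear : ∀ z, ¬ Ear G x yv z := by
    intro z hz
    have y1 : Y2 G x yv (z + 1) := ⟨hz.not_adj rfl, hmid _⟩
    have y2 : Y2 G x yv (z - 1) := ⟨fun h => h.not_adj (by ring) hz, hmid _⟩
    obtain ⟨c, hl, hc⟩ := exists_succ y1
    have := hl.lt
    refine hb (z + 1) (z - 1 + D) (yv z) ⟨by omega, by omega, H.nex _, y1, (Y2.shift H).mpr y2,
      Or.inr (hz.adj_hi H rfl), At.shift H (Or.inr (hz.adj_lo H rfl)),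
      c, by omega, by omega, hc, ?_⟩
    rintro (h | h)
    · exact H.ne' (i := z) (j := c) (by omega) (by omega) (by omega) h
    · rcases hz.nbr (H.adjx c) h rfl rfl with h | h <;>
        exact H.ne' (by omega) (by omega) (by omega) h
  exact ⟨hear i, hmid i⟩

theorem exists_bad (H : MdlCtx G x yv D) : ∃ p q w, Bad G x yv D p q w := by
  classical
  by_contra hb
  push Not at hb
  have hY := H.all_Y2 hb
  have hD := H.hD
  -- some vertex attached twice
  obtain ⟨w, hwx, m, hm0, hmD, hw0, hwm⟩ : ∃ w, w ≠ x ∧ ∃ m, 0 < m ∧ m < D ∧ At G yv w 0 ∧ At G yv w m := by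
    by_contra hno
    push Not at hno
    have hz : ∀ z, G.Adj x z → z ≠ yv 0 → ∀ u, u ≠ x → At G yv u 0 → ¬ (u = z ∨ G.Adj u z) := by
      intro z hz hz0 u hux hu0 huz
      obtain ⟨m, h1, h2, rfl⟩ := H.rep 0 hz
      have : m ≠ 0 := by rintro rfl; exact hz0 rfl
      exact hno u hux m (by omega) (by omega) hu0 huz
    have s := H.star 0 ((G.neighborFinset (yv 0)).erase x) ∅ ∅ 2 (by simp)
      (fun u h => mem_N'.mp h)
      (by
        intro z hxz hz0 hzz
        exfalso
        rcases hzz with h | ⟨u, hu, huz⟩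
        · exact hz z hxz hz0 (yv 0) (H.nex 0) (Or.inl rfl) (Or.inr h)
        · have := mem_N'.mp hu
          exact hz z hxz hz0 u this.2 (Or.inr this.1.symm) (Or.inr huz))
      (by
        intro u hu hxu
        exfalso
        have := mem_N'.mp hu
        exact hz u hxu this.1.ne' u this.2 (Or.inr this.1.symm) (Or.inl rfl))
    have h1 := H.card_N' 0
    have h2 := H.deg (yv 0)
    omega
  have hall : ∀ c, At G yv w c := by
    intro c
    obtain ⟨r, r1, r2, r3⟩ := H.rep 0 (H.adjx c)
    suffices At G yv w r by unfold At at this ⊢; rwa [r3] at this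
    by_contra hr
    have e0 : r ≠ 0 := by rintro rfl; exact hr hw0
    have em : r ≠ m := by rintro rfl; exact hr hwm
    rcases lt_or_gt_of_ne em with h | h
    · exact hb 0 m w ⟨hm0, by omega, hwx, hY _, hY _, hw0, hwm, r, by omega, h, hY _, hr⟩
    · exact hb m (0 + D) w ⟨by omega, by omega, hwx, hY _, hY _, hwm, hw0.shift H, r, h, by omega, hY _, hr⟩
  obtain ⟨i, hi⟩ : ∃ i : ℤ, ∀ c, i - 2 ≤ c → c ≤ i + 2 → w ≠ yv c := by
    by_cases h : ∃ j, w = yv j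
    · obtain ⟨j, rfl⟩ := h
      exact ⟨j + 3, fun c h1 h2 => H.ne' (by omega) (by omega) (by omega)⟩
    · push Not at h
      exact ⟨0, fun c _ _ => h c⟩
  have hadj : ∀ c, i - 2 ≤ c → c ≤ i + 2 → G.Adj w (yv c) := fun c h1 h2 =>
    (hall c).resolve_left (hi c h1 h2)
  exact H.LR hwx (hadj _ (by omega) (by omega)) (hadj _ (by omega) (by omega))
    (hadj i (by omega) (by omega)) (hadj _ (by omega) (by omega)) (hadj _ (by omega) (by omega))

/-- A minimal bad interval. -/
structure MinBad (G : SimpleGraph V) [G.LocallyFinite] (x : V) (yv : ℤ → V) (D : ℤ) (p q : ℤ) (w : V) :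
    Prop where
  pq : p < q
  qD : q < p + D
  wx : w ≠ x
  Yp : Y2 G x yv p
  Yq : Y2 G x yv q
  Bp : At G yv w p
  Bq : At G yv w q
  ex : ∃ c, p < c ∧ c < q ∧ Y2 G x yv c
  int : ∀ c, p < c → c < q → Y2 G x yv c → ¬ At G yv w c
  run : ∀ a b c u, p ≤ a → b ≤ q → b - a < q - p → Y2 G x yv a → Y2 G x yv b → u ≠ x →
    At G yv u a → At G yv u b → a < c → c < b → Y2 G x yv c → At G yv u c

theorem exists_minBad (H : MdlCtx G x yv D) : ∃ p q w, MinBad G x yv D p q w := by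
  classical
  have h0 : ∃ n : ℕ, ∃ p q w, Bad G x yv D p q w ∧ (q - p).toNat = n := by
    obtain ⟨p, q, w, h⟩ := H.exists_bad
    exact ⟨_, p, q, w, h, rfl⟩
  obtain ⟨p, q, w, hbad, hn⟩ := Nat.find_spec h0
  have hmin : ∀ p' q' w', Bad G x yv D p' q' w' → q - p ≤ q' - p' := by
    intro p' q' w' h
    by_contra hlt
    have := h.1
    refine Nat.find_min h0 (m := (q' - p').toNat) (by omega) ⟨p', q', w', h, rfl⟩
  obtain ⟨h1, h2, h3, h4, h5, h6, h7, c0, c1, c2, c3, c4⟩ := hbad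
  refine ⟨p, q, w, h1, h2, h3, h4, h5, h6, h7, ⟨c0, c1, c2, c3⟩, ?_, ?_⟩
  · intro c p1 p2 hc hw
    have hne : c0 ≠ c := by rintro rfl; exact c4 hw
    rcases lt_or_gt_of_ne hne with h | h
    · have := hmin p c w ⟨p1, by omega, h3, h4, hc, h6, hw, c0, c1, h, c3, c4⟩
      omega
    · have := hmin c q w ⟨p2, by omega, h3, hc, h5, hw, h7, c0, h, c2, c3, c4⟩
      omega
  · intro a b c u pa bq hlt ya yb ux ua ub ac cb yc
    by_contra hcon
    have := hmin a b u ⟨by omega, by omega, ux, ya, yb, ua, ub, c, ac, cb, yc, hcon⟩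
    omega

namespace MinBad

variable {p q : ℤ} {w : V}

theorem confA (B : MinBad G x yv D p q w) (H : MdlCtx G x yv D) {c : ℤ} (h1 : p < c) (h2 : c < q)
    (hc : Y2 G x yv c) {v : V} (hv : G.Adj x v) (hcv : G.Adj (yv c) v) :
    ∃ m, p ≤ m ∧ m ≤ q ∧ yv m = v := by
  have hi := B.int c h1 h2 hc
  have hqD := B.qD
  have hwc : w ≠ yv c := fun h => hi (Or.inl h)
  rcases H.sep h1 h2 B.wx B.Bp B.Bq hwc (H.nex c) hwc.symm (H.ne (by omega) (by omega) (by omega))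
    (H.ne (by omega) (by omega) (by omega)) (Or.inl rfl) hv (Or.inr hcv) with h | h
  · subst h
    exact absurd (Or.inr hcv.symm) hi
  · exact h

theorem confU (B : MinBad G x yv D p q w) (H : MdlCtx G x yv D) {c : ℤ} (h1 : p < c) (h2 : c < q)
    (hc : Y2 G x yv c) {u : V} (hu : G.Adj (yv c) u) (hux : u ≠ x) (hup : u ≠ yv p) (huq : u ≠ yv q)
    {v : V} (hv : G.Adj x v) (huv : G.Adj u v) :
    v = w ∨ ∃ m, p ≤ m ∧ m ≤ q ∧ yv m = v := by
  have hi := B.int c h1 h2 hc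
  have hwc : w ≠ yv c := fun h => hi (Or.inl h)
  have huw : u ≠ w := by rintro rfl; exact hi (Or.inr hu.symm)
  exact H.sep h1 h2 B.wx B.Bp B.Bq hwc hux huw hup huq (Or.inr hu.symm) hv (Or.inr huv)

theorem caseA (B : MinBad G x yv D p q w) (H : MdlCtx G x yv D) {a b c : ℤ} (hpa : p ≤ a) (hbq : b ≤ q)
    (hlt : b - a < q - p) (ya : Y2 G x yv a) (yb : Y2 G x yv b) (hab : G.Adj (yv a) (yv b))
    (hac : a < c) (hcb : c < b) (yc : Y2 G x yv c) : False := by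
  have hqD := B.qD
  have ra : ∀ s, a < s → s < b → Y2 G x yv s → G.Adj (yv a) (yv s) := fun s h1 h2 hs =>
    (B.run a b s (yv a) hpa hbq hlt ya yb (H.nex a) (Or.inl rfl) (Or.inr hab) h1 h2 hs).resolve_left
      (H.ne (by omega) (by omega) (by omega))
  have rb : ∀ s, a < s → s < b → Y2 G x yv s → G.Adj (yv b) (yv s) := fun s h1 h2 hs =>
    (B.run a b s (yv b) hpa hbq hlt ya yb (H.nex b) (Or.inr hab.symm) (Or.inl rfl) h1 h2 hs).resolve_left
      (H.ne (by omega) (by omega) (by omega))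
  have two : ∀ s t, a < s → s < t → t < b → Y2 G x yv s → Y2 G x yv t → False := by
    intro s t h1 h2 h3 hs ht
    exact H.cross a s t b h1 h2 h3 (by omega) (yv a) (yv b) (H.nex _) (H.nex _) hab.ne
      (H.ne (by omega) (by omega) (by omega)) hab.ne hab.ne'
      (H.ne (by omega) (by omega) (by omega)) (Or.inl rfl) (Or.inr (ra t (by omega) h3 ht))
      (Or.inr (rb s h1 (by omega) hs)) (Or.inl rfl)
  have la : Link G x yv a c := by
    obtain ⟨a', l, y⟩ := exists_pred yc
    have := l.lt
    rcases lt_trichotomy a a' with h | h | h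
    · exact (two a' c h this.1 hcb y yc).elim
    · rwa [h]
    · exact (l.no_between ya h hac).elim
  have lb : Link G x yv c b := by
    obtain ⟨b', l, y⟩ := exists_succ yc
    have := l.lt
    rcases lt_trichotomy b b' with h | h | h
    · exact (l.no_between yb hcb h).elim
    · rwa [h]
    · exact (two c b' hac this.1 h yc y).elim
  have hca : yv a ≠ yv c := H.ne (by omega) (by omega) (by omega)
  have hcb' : yv c ≠ yv b := H.ne (by omega) (by omega) (by omega)
  refine H.pocket yc la lb ?_ (yv a) ?_
  · intro v hv hcv
    rcases H.sep hac hcb (H.nex a) (Or.inl rfl) (Or.inr hab) hca (H.nex c) hca.symm hca.symm hcb'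
      (Or.inl rfl) hv (Or.inr hcv) with h | h
    · exact ⟨a, le_rfl, by omega, h.symm⟩
    · exact h
  · intro u hu hux hua hub v hv huv
    exact H.sep hac hcb (H.nex a) (Or.inl rfl) (Or.inr hab) hca hux hua hua hub
      (Or.inr hu.symm) hv (Or.inr huv)

/-- local confinement -/
theorem near (B : MinBad G x yv D p q w) (H : MdlCtx G x yv D) {a b c : ℤ} (h1 : p < c) (h2 : c < q)
    (yc : Y2 G x yv c) (ya : Y2 G x yv a) (yb : Y2 G x yv b) (la : a < c) (lb : c < b)
    {v : V} (hv : G.Adj x v) (hcv : G.Adj (yv c) v) :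
    ∃ m, a ≤ m ∧ m ≤ b ∧ yv m = v := by
  have hqD := B.qD
  obtain ⟨m, m1, m2, rfl⟩ := B.confA H h1 h2 yc hv hcv
  refine ⟨m, ?_, ?_, rfl⟩
  · by_contra hm
    push Not at hm
    by_cases hY : Y2 G x yv m
    · exact B.caseA H m1 (by omega) (by omega) hY yc hcv.symm hm la ya
    have hmp : m ≠ p := by rintro rfl; exact hY B.Yp
    have hcase : Ear G x yv m ∨ Mid G x yv m := by unfold Y2 at hY; tauto
    rcases hcase with he | hmid
    · rcases he.nbr (H.adjx c) hcv.symm rfl rfl with h | h <;>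
      · have := H.inj h (by omega) (by omega)
        omega
    · rcases hmid.nbr (H.adjx c) hcv.symm rfl rfl rfl rfl with h | h | h | h
      on_goal 4 =>
        have := H.inj h (by omega) (by omega)
        have e : a = m + 1 := by omega
        rw [e] at ya
        exact ya.1 hmid.2.2
      all_goals
        have := H.inj h (by omega) (by omega)
        omega
  · by_contra hm
    push Not at hm
    by_cases hY : Y2 G x yv m
    · exact B.caseA H (by omega) m2 (by omega) yc hY hcv lb hm yb
    have hmp : m ≠ q := by rintro rfl; exact hY B.Yq
    have hcase : Ear G x yv m ∨ Mid G x yv m := by unfold Y2 at hY; tauto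
    rcases hcase with he | hmid
    · rcases he.nbr (H.adjx c) hcv.symm rfl rfl with h | h <;>
      · have := H.inj h (by omega) (by omega)
        omega
    · rcases hmid.nbr (H.adjx c) hcv.symm rfl rfl rfl rfl with h | h | h | h
      on_goal 1 =>
        have := H.inj h (by omega) (by omega)
        have e : b = m - 1 := by omega
        rw [e] at yb
        exact yb.1 hmid.2.1
      all_goals
        have := H.inj h (by omega) (by omega)
        omega

theorem loc (B : MinBad G x yv D p q w) (H : MdlCtx G x yv D) {y : ℤ} (h1 : p < y) (h2 : y < q)
    (hy : Y2 G x yv y) :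
    (Y2 G x yv (y - 1) ∧ Y2 G x yv (y + 1) ∧
      ∀ v, G.Adj x v → G.Adj (yv y) v → v = yv (y - 1) ∨ v = yv (y + 1)) ∨
    (Ear G x yv (y - 1) ∧ Ear G x yv (y + 1) ∧ Y2 G x yv (y - 2) ∧ Y2 G x yv (y + 2) ∧
      p ≤ y - 2 ∧ y + 2 ≤ q ∧
      ∀ v, G.Adj x v → G.Adj (yv y) v →
        v = yv (y - 2) ∨ v = yv (y - 1) ∨ v = yv (y + 1) ∨ v = yv (y + 2)) := by
  obtain ⟨a, la, ya⟩ := exists_pred hy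
  obtain ⟨b, lb, yb⟩ := exists_succ hy
  have l1 := la.lt
  have l2 := lb.lt
  have hpa : p ≤ a := by
    by_contra h
    exact la.no_between B.Yp (by omega) h1
  have hbq : b ≤ q := by
    by_contra h
    exact lb.no_between B.Yq h2 (by omega)
  have hn : ∀ v, G.Adj x v → G.Adj (yv y) v → ∃ m, a ≤ m ∧ m ≤ b ∧ yv m = v := fun v hv hyv =>
    B.near H h1 h2 hy ya yb l1.1 l2.1 hv hyv
  rcases conf_link la lb hn with ⟨rfl, rfl⟩ | ⟨rfl, rfl, e1, e2⟩
  · left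
    refine ⟨ya, yb, ?_⟩
    intro v hv hyv
    obtain ⟨m, m1, m2, rfl⟩ := hn v hv hyv
    have hmc : m ≠ y := by rintro rfl; exact hyv.ne rfl
    have : m = y - 1 ∨ m = y + 1 := by omega
    rcases this with h | h <;> rw [h] <;> simp
  · right
    refine ⟨e1, e2, ya, yb, hpa, hbq, ?_⟩
    intro v hv hyv
    obtain ⟨m, m1, m2, rfl⟩ := hn v hv hyv
    have hmc : m ≠ y := by rintro rfl; exact hyv.ne rfl
    have : m = y - 2 ∨ m = y - 1 ∨ m = y + 1 ∨ m = y + 2 := by omega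
    rcases this with h | h | h | h <;> rw [h] <;> simp

theorem noear (B : MinBad G x yv D p q w) (H : MdlCtx G x yv D) {y z : ℤ} (h1 : p < y) (h2 : z < q)
    (hz : z = y + 2) (yy : Y2 G x yv y) (yz : Y2 G x yv z) (he : Ear G x yv (y + 1)) : False := by
  classical
  rcases B.loc H h1 (by omega) yy with ⟨_, h, _⟩ | ⟨_, _, _, _, _, _, hA⟩
  · exact h.1 he
  rcases B.loc H (by omega) h2 yz with ⟨h, _⟩ | ⟨_, _, _, _, _, _, hB⟩
  · rw [show z - 1 = y + 1 by omega] at h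
    exact h.1 he
  refine he.both (a := y) (b := z) (by omega) (by omega)
    {yv (y - 2), yv (y - 1), yv (z + 1), yv (z + 2)} (Finset.card_le_four.trans (by norm_num)) ?_
  intro v hv hvv
  simp only [Finset.mem_insert, Finset.mem_singleton]
  rcases hvv with h | h
  · have := hA v hv h
    rw [← hz] at this
    tauto
  · have := hB v hv h
    rw [show z - 2 = y by omega, show z - 1 = y + 1 by omega] at this
    tauto

/-- exactly one interior index is impossible -/
theorem two_int (B : MinBad G x yv D p q w) (H : MdlCtx G x yv D) :
    ∃ s t, p < s ∧ s < t ∧ t < q ∧ Y2 G x yv s ∧ Y2 G x yv t := by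
  by_contra hno
  push Not at hno
  obtain ⟨c, c1, c2, yc⟩ := B.ex
  have la : Link G x yv p c := by
    obtain ⟨a', l, y⟩ := exists_pred yc
    have := l.lt
    rcases lt_trichotomy p a' with h | h | h
    · exact (hno a' c h this.1 c2 y yc).elim
    · rwa [h]
    · exact (l.no_between B.Yp h c1).elim
  have lb : Link G x yv c q := by
    obtain ⟨b', l, y⟩ := exists_succ yc
    have := l.lt
    rcases lt_trichotomy q b' with h | h | h
    · exact (l.no_between B.Yq c2 h).elim
    · rwa [h]
    · exact (hno c b' c1 this.1 h yc y).elim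
  exact H.pocket yc la lb (fun v hv h => B.confA H c1 c2 yc hv h) w
    (fun u hu a b d v hv h => B.confU H c1 c2 yc hu a b d hv h)

theorem simple (B : MinBad G x yv D p q w) (H : MdlCtx G x yv D) {y : ℤ} (h1 : p < y) (h2 : y < q)
    (hy : Y2 G x yv y) :
    Y2 G x yv (y - 1) ∧ Y2 G x yv (y + 1) ∧
      ∀ v, G.Adj x v → G.Adj (yv y) v → v = yv (y - 1) ∨ v = yv (y + 1) := by
  rcases B.loc H h1 h2 hy with h | ⟨e1, e2, y1, y2, hp, hq, _⟩
  · exact h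
  exfalso
  have hp' : y - 2 = p := by
    by_contra hne
    exact B.noear H (y := y - 2) (z := y) (by omega) h2 (by ring) y1 hy
      (by rwa [show y - 2 + 1 = y - 1 by ring])
  have hq' : y + 2 = q := by
    by_contra hne
    exact B.noear H (y := y) (z := y + 2) h1 (by omega) rfl hy y2 e2
  obtain ⟨s, t, s1, s2, s3, ys, yt⟩ := B.two_int H
  have : s = y - 1 ∨ t = y + 1 := by omega
  rcases this with h | h
  · rw [h] at ys; exact ys.1 e1
  · rw [h] at yt; exact yt.1 e2

theorem allY (B : MinBad G x yv D p q w) (H : MdlCtx G x yv D) {y : ℤ} (h1 : p ≤ y) (h2 : y ≤ q) :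
    Y2 G x yv y := by
  obtain ⟨c, c1, c2, yc⟩ := B.ex
  have up : ∀ n : ℕ, c + n ≤ q → Y2 G x yv (c + n) := by
    intro n
    induction n with
    | zero => intro _; simpa using yc
    | succ n ih =>
      intro h
      push_cast at h ⊢
      rw [← add_assoc]
      exact (B.simple H (by omega) (by omega) (ih (by omega))).2.1
  have dn : ∀ n : ℕ, p ≤ c - n → Y2 G x yv (c - n) := by
    intro n
    induction n with
    | zero => intro _; simpa using yc
    | succ n ih =>
      intro h
      push_cast at h ⊢
      rw [← sub_sub]
      exact (B.simple H (by omega) (by omega) (ih (by omega))).1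
  rcases le_total c y with h | h
  · have := up (y - c).toNat (by omega)
    rwa [show c + ((y - c).toNat : ℤ) = y by omega] at this
  · have := dn (c - y).toNat (by omega)
    rwa [show c - ((c - y).toNat : ℤ) = y by omega] at this

theorem nb (B : MinBad G x yv D p q w) (H : MdlCtx G x yv D) {y a b : ℤ} (h1 : p < y) (h2 : y < q)
    (ha : a = y - 1) (hb : b = y + 1) {v : V} (hv : G.Adj x v) (hyv : G.Adj (yv y) v) :
    v = yv a ∨ v = yv b := by
  subst ha hb
  exact (B.simple H h1 h2 (B.allY H h1.le h2.le)).2.2 v hv hyv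

theorem big (B : MinBad G x yv D p q w) (H : MdlCtx G x yv D) (h4 : p + 4 ≤ q) : False := by
  classical
  have hqD := B.qD
  have hD := H.hD
  have yy := B.allY H (y := p + 2) (by omega) (by omega)
  have hk := H.deg (yv (p + 2))
  have hc := H.card_N' (p + 2)
  have s := H.star (p + 2) ((G.neighborFinset (yv (p + 2))).erase x)
    {yv p, yv (p + 1), yv (p + 3), yv (p + 4), yv (p + 5), w} {yv (p + 1), yv (p + 3)} 10
    (by
      have a1 : ({yv p, yv (p + 1), yv (p + 3), yv (p + 4), yv (p + 5), w} : Finset V).card ≤ 6 :=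
        Finset.card_le_six
      have a2 : ({yv (p + 1), yv (p + 3)} : Finset V).card ≤ 2 := Finset.card_le_two
      omega)
    (fun u h => mem_N'.mp h)
    (by
      intro z hz hzy hzz
      simp only [Finset.mem_insert, Finset.mem_singleton]
      rcases hzz with h | ⟨u, hu, huz⟩
      · have := B.nb H (y := p + 2) (a := p + 1) (b := p + 3) (by omega) (by omega) (by omega) (by omega) hz h
        tauto
      · obtain ⟨hyu, hux⟩ := mem_N'.mp hu
        by_cases hxu : G.Adj x u
        · rcases B.nb H (y := p + 2) (a := p + 1) (b := p + 3) (by omega) (by omega) (by omega) (by omega) hxu hyu with rfl | rfl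
          · have := B.nb H (y := p + 1) (a := p) (b := p + 2) (by omega) (by omega) (by omega) (by omega) hz huz
            tauto
          · have := B.nb H (y := p + 3) (a := p + 2) (b := p + 4) (by omega) (by omega) (by omega) (by omega) hz huz
            tauto
        · have huY : ∀ i, u ≠ yv i := by rintro i rfl; exact hxu (H.adjx i)
          rcases B.confU H (c := p + 2) (by omega) (by omega) yy hyu hux (huY _) (huY _) hz huz with h | ⟨m, m1, m2, rfl⟩
          · tauto
          · have hm2 : m ≠ p + 2 := by rintro rfl; exact hzy rfl
            have hm6 : m < p + 6 := by
              by_contra hm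
              have hadj : ∀ i, p + 2 < i → i < m → G.Adj u (yv i) := fun i i1 i2 =>
                (B.run (p + 2) m i u (by omega) m2 (by omega) yy (B.allY H m1 m2) hux
                  (Or.inr hyu.symm) (Or.inr huz) i1 i2 (B.allY H (by omega) (by omega))).resolve_left (huY i)
              have h6 : G.Adj u (yv (p + 6)) := by
                rcases (show m = p + 6 ∨ p + 6 < m by omega) with h | h
                · rwa [← h]
                · exact hadj _ (by omega) h
              refine H.LR (i := p + 4) hux ?_ (hadj _ (by omega) (by omega))
                (hadj _ (by omega) (by omega)) (hadj _ (by omega) (by omega)) ?_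
              · rw [show p + 4 - 2 = p + 2 by ring]; exact hyu.symm
              · rwa [show p + 4 + 2 = p + 6 by ring]
            have : m = p ∨ m = p + 1 ∨ m = p + 3 ∨ m = p + 4 ∨ m = p + 5 := by omega
            rcases this with h | h | h | h | h <;> rw [h] <;> simp)
    (by
      intro u hu hxu
      have := B.nb H (y := p + 2) (a := p + 1) (b := p + 3) (by omega) (by omega) (by omega) (by omega) hxu (mem_N'.mp hu).1
      simpa using this)
  omega

theorem small (B : MinBad G x yv D p q w) (H : MdlCtx G x yv D) (h3 : q = p + 3) : False := by
  classical
  have hqD := B.qD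
  have hD := H.hD
  have yy := B.allY H (y := p + 1) (by omega) (by omega)
  have hk := H.deg (yv (p + 1))
  have hc := H.card_N' (p + 1)
  have nb1 : ∀ {v}, G.Adj x v → G.Adj (yv (p + 1)) v → v = yv p ∨ v = yv (p + 2) := fun hv h =>
    B.nb H (y := p + 1) (by omega) (by omega) (by omega) (by omega) hv h
  have nb2 : ∀ {v}, G.Adj x v → G.Adj (yv (p + 2)) v → v = yv (p + 1) ∨ v = yv (p + 3) := fun hv h =>
    B.nb H (y := p + 2) (by omega) (by omega) (by omega) (by omega) hv h
  set S := ((G.neighborFinset (yv (p + 1))).erase x).erase (yv p) with hS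
  have hSc : G.degree (yv (p + 1)) ≤ S.card + 2 := by
    have := Finset.pred_card_le_card_erase (s := (G.neighborFinset (yv (p + 1))).erase x) (a := yv p)
    rw [← hS] at this
    omega
  have hSm : ∀ u ∈ S, G.Adj (yv (p + 1)) u ∧ u ≠ x ∧ u ≠ yv p := by
    intro u hu
    obtain ⟨a, b⟩ := Finset.mem_erase.mp hu
    have := mem_N'.mp b
    tauto
  have hZ : ∀ z, G.Adj x z → z ≠ yv (p + 1) → (G.Adj (yv (p + 1)) z ∨ ∃ u ∈ S, G.Adj u z) →
      z ∈ ({yv p, yv (p + 2), yv (p + 3), w} : Finset V) := by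
    intro z hz hzy hzz
    simp only [Finset.mem_insert, Finset.mem_singleton]
    rcases hzz with h | ⟨u, hu, huz⟩
    · have := nb1 hz h
      tauto
    · obtain ⟨u1, u2, u3⟩ := hSm u hu
      have huq : u ≠ yv q := by
        rintro rfl
        rcases nb1 (H.adjx q) u1 with h | h
        · exact u3 h
        · exact H.ne' (i := q) (j := p + 2) (by omega) (by omega) (by omega) h
      rcases B.confU H (c := p + 1) (by omega) (by omega) yy u1 u2 u3 huq hz huz with h | ⟨m, m1, m2, rfl⟩
      · tauto
      · have hm2 : m ≠ p + 1 := by rintro rfl; exact hzy rfl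
        have : m = p ∨ m = p + 2 ∨ m = p + 3 := by omega
        rcases this with h | h | h <;> rw [h] <;> simp
  have hZc : ({yv p, yv (p + 2), yv (p + 3), w} : Finset V).card ≤ 4 := Finset.card_le_four
  by_cases hadj : G.Adj (yv (p + 1)) (yv (p + 2))
  · have s := H.star (p + 1) S _ {yv (p + 2)} 7 (by rw [Finset.card_singleton]; omega)
      (fun u h => ⟨(hSm u h).1, (hSm u h).2.1⟩) hZ
      (by
        intro u hu hxu
        obtain ⟨u1, u2, u3⟩ := hSm u hu
        have := nb1 hxu u1
        simp only [Finset.mem_singleton]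
        tauto)
    have s2 := H.star (p + 1) {yv (p + 2)} {yv p, yv (p + 2), yv (p + 3)} {yv (p + 2)} 6
      (by
        have a1 : ({yv p, yv (p + 2), yv (p + 3)} : Finset V).card ≤ 3 := Finset.card_le_three
        rw [Finset.card_singleton]; omega)
      (by
        intro u hu
        rw [Finset.mem_singleton] at hu
        subst hu
        exact ⟨hadj, H.nex _⟩)
      (by
        intro z hz hzy hzz
        simp only [Finset.mem_insert, Finset.mem_singleton]
        rcases hzz with h | ⟨u, hu, huz⟩
        · have := nb1 hz h
          tauto
        · rw [Finset.mem_singleton] at hu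
          subst hu
          have := nb2 hz huz
          tauto)
      (fun u h _ => h)
    rw [Finset.card_singleton] at s2
    omega
  · have s := H.star (p + 1) S _ ∅ 6 (by rw [Finset.card_empty]; omega)
      (fun u h => ⟨(hSm u h).1, (hSm u h).2.1⟩) hZ
      (by
        intro u hu hxu
        exfalso
        obtain ⟨u1, u2, u3⟩ := hSm u hu
        rcases nb1 hxu u1 with h | h
        · exact u3 h
        · rw [h] at u1; exact hadj u1)
    omega

end MinBad

theorem absurd_ctx (H : MdlCtx G x yv D) : False := by
  obtain ⟨p, q, w, B⟩ := H.exists_minBad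
  obtain ⟨s, t, s1, s2, s3, _, _⟩ := B.two_int H
  rcases (show q = p + 3 ∨ p + 4 ≤ q by omega) with h | h
  · exact B.small H h
  · exact B.big H h

end MdlCtx

/-- A simple connected positively curved planar graph with minimum degree at least 3
has maximum degree at most 17. -/
theorem max_degree_le_seventeen (G : SimpleGraph V) [G.LocallyFinite]
    (hconn : G.Connected) (hplanar : IsPlanar G)
    (hmin : ∀ u : V, 3 ≤ G.degree u) (hpos : PositivelyCurved G) :
    ∀ u : V, G.degree u ≤ 17 := by
  intro x
  by_contra hx
  have h18 : 18 ≤ G.degree x := by omega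
  obtain ⟨yv, h1, h2, h3⟩ := mdl_cyclic G hplanar x (by omega)
  have H : MdlCtx G x yv (G.degree x : ℤ) := by
    refine ⟨by exact_mod_cast h18, h1, h2, h3, hmin, ?_⟩
    intro i S Z M t ht hS hZ hM
    have := mdl_star G hconn hpos ((h2 (yv i)).mpr ⟨i, rfl⟩) h18 S Z M hS hZ hM
    exact this.trans_le (Nat.mul_le_mul_left _ ht)
  exact H.absurd_ctx
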